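/- arXiv:2104.10080 — 5 statements merged into one kernel-verified Lean document; each statement's English description precedes it below -/
import Mathlib

section
/- Let n be an odd positive integer not divisible by 3, with n ≥ 4. If G is a finite simple graph with I(G,x) = I(C_n,x), then G is isomorphic to C_n or to D_n. -/
open Polynomial SimpleGraph

/-- A finset of vertices is independent if no two of its vertices are adjacent. -/
def SimpleGraph.IsIndepFinset {V : Type*} (G : SimpleGraph V) (s : Finset V) : Prop :=
  ∀ v ∈ s, ∀ w ∈ s, ¬ G.Adj v w

open scoped Classical in
/-- The independence polynomial `I(G,x) = Σ_k i_k(G) xᵏ` of a finite simple graph,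
regarded as a polynomial with rational coefficients. -/
noncomputable def SimpleGraph.indepPoly {V : Type*} [Fintype V] (G : SimpleGraph V) :
    Polynomial ℚ :=
  ∑ s : Finset V, if G.IsIndepFinset s then (X : Polynomial ℚ) ^ s.card else 0

/-- `Dgraph n` : the graph on `n` vertices consisting of a triangle (on `0,1,2`)
together with a path on `n-3` vertices (`3, …, n-1`) whose endpoint is joined to
the triangle vertex `2`. -/
def Dgraph (n : ℕ) : SimpleGraph (Fin n) :=
  SimpleGraph.fromRel (fun i j => i.val + 1 = j.val ∨ (i.val = 0 ∧ j.val = 2))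


namespace ICE

open scoped Classical in
noncomputable def wt {V : Type*} (G : SimpleGraph V) (s : Finset V) : ℚ[X] :=
  if G.IsIndepFinset s then (X : ℚ[X]) ^ s.card else 0

noncomputable def IP {V : Type*} (G : SimpleGraph V) (A : Finset V) : ℚ[X] :=
  ∑ s ∈ A.powerset, wt G s

lemma IP_univ {V : Type*} [Fintype V] (G : SimpleGraph V) : G.indepPoly = IP G Finset.univ := by
  unfold SimpleGraph.indepPoly IP wt
  simp

lemma wt_empty {V : Type*} (G : SimpleGraph V) : wt G ∅ = 1 := by
  simp [wt, SimpleGraph.IsIndepFinset]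

lemma IP_empty {V : Type*} (G : SimpleGraph V) : IP G ∅ = 1 := by
  simp [IP, wt_empty]

lemma wt_insert {V : Type*} [DecidableEq V] (G : SimpleGraph V) {v : V} {t : Finset V}
    (hv : v ∉ t) (ht : ∀ w ∈ t, ¬ G.Adj v w) : wt G (insert v t) = X * wt G t := by
  have : G.IsIndepFinset (insert v t) ↔ G.IsIndepFinset t := by
    constructor
    · intro h a ha b hb
      exact h a (Finset.mem_insert_of_mem ha) b (Finset.mem_insert_of_mem hb)
    · intro h a ha b hb
      rcases Finset.mem_insert.1 ha with h1 | h1 <;> rcases Finset.mem_insert.1 hb with h2 | h2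
      · subst h1; subst h2; exact G.loopless.irrefl _
      · subst h1; exact ht _ h2
      · subst h2; exact fun hh => ht a h1 hh.symm
      · exact h a h1 b h2
  unfold wt
  rw [Finset.card_insert_of_notMem hv]
  by_cases h : G.IsIndepFinset t
  · rw [if_pos h, if_pos (this.2 h)]; ring
  · rw [if_neg h, if_neg (fun hh => h (this.1 hh))]; simp

lemma IP_insert {V : Type*} [DecidableEq V] (G : SimpleGraph V) {v : V} {A B : Finset V}
    (hv : v ∉ A) (hB : ∀ w, w ∈ B ↔ w ∈ A ∧ ¬ G.Adj v w) :
    IP G (insert v A) = IP G A + X * IP G B := by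
  unfold IP
  rw [Finset.sum_powerset_insert hv]
  congr 1
  rw [Finset.mul_sum]
  have hBA : B.powerset ⊆ A.powerset := by
    apply Finset.powerset_mono.2
    intro w hw
    exact ((hB w).1 hw).1
  symm
  calc ∑ t ∈ B.powerset, X * wt G t = ∑ t ∈ B.powerset, wt G (insert v t) := by
        apply Finset.sum_congr rfl
        intro t ht
        rw [Finset.mem_powerset] at ht
        rw [wt_insert]
        · intro h; exact hv ((hB _).1 (ht h)).1
        · intro w hw; exact ((hB _).1 (ht hw)).2
    _ = _ := by
        apply Finset.sum_subset hBA
        intro t ht htB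
        rw [Finset.mem_powerset] at ht htB
        obtain ⟨w, hw, hwB⟩ := Finset.not_subset.1 htB
        have hadj : G.Adj v w := by
          by_contra hc
          exact hwB ((hB w).2 ⟨ht hw, hc⟩)
        unfold wt
        rw [if_neg]
        intro h
        exact h v (Finset.mem_insert_self _ _) w (Finset.mem_insert_of_mem hw) hadj

lemma IP_mul {V : Type*} [DecidableEq V] (G : SimpleGraph V) (B : Finset V) :
    ∀ A : Finset V, Disjoint A B → (∀ a ∈ A, ∀ b ∈ B, ¬ G.Adj a b) →
    IP G (A ∪ B) = IP G A * IP G B := by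
  classical
  intro A
  induction A using Finset.strongInduction with
  | H A ih =>
    intro hd hadj
    rcases A.eq_empty_or_nonempty with rfl | ⟨v, hv⟩
    · simp [IP_empty]
    · have e1 : A = insert v (A.erase v) := (Finset.insert_erase hv).symm
      have hvB : v ∉ B := Finset.disjoint_left.1 hd hv
      have hA : IP G A = IP G (A.erase v) + X * IP G ((A.erase v).filter (fun w => ¬ G.Adj v w)) := by
        conv_lhs => rw [e1]
        exact IP_insert G (by simp) (by simp)
      have hAB : IP G (A ∪ B) = IP G (A.erase v ∪ B) +
          X * IP G ((A.erase v).filter (fun w => ¬ G.Adj v w) ∪ B) := by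
        have : A ∪ B = insert v (A.erase v ∪ B) := by
          rw [← Finset.insert_union, Finset.insert_erase hv]
        rw [this]
        apply IP_insert G (by simp [hvB])
        intro w
        simp only [Finset.mem_union, Finset.mem_filter]
        constructor
        · rintro (⟨h1, h2⟩ | h)
          · exact ⟨Or.inl h1, h2⟩
          · exact ⟨Or.inr h, hadj v hv w h⟩
        · rintro ⟨h1 | h1, h2⟩
          · exact Or.inl ⟨h1, h2⟩
          · exact Or.inr h1
      have s1 : A.erase v ⊂ A := Finset.erase_ssubset hv
      have s2 : (A.erase v).filter (fun w => ¬ G.Adj v w) ⊂ A :=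
        lt_of_le_of_lt (Finset.filter_subset _ _) s1
      rw [hAB, hA, ih _ s1 (Finset.disjoint_of_subset_left s1.1 hd)
        (fun a ha => hadj a (s1.1 ha)), ih _ s2 (Finset.disjoint_of_subset_left s2.1 hd)
        (fun a ha => hadj a (s2.1 ha))]
      ring

lemma IP_map {V W : Type*} (G : SimpleGraph V) (H : SimpleGraph W) (f : W ↪ V)
    (hf : ∀ a b, G.Adj (f a) (f b) ↔ H.Adj a b) (A : Finset W) :
    IP G (A.map f) = IP H A := by
  classical
  induction A using Finset.strongInduction with
  | H A ih =>
    rcases A.eq_empty_or_nonempty with rfl | ⟨v, hv⟩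
    · simp [IP_empty]
    · have s1 : A.erase v ⊂ A := Finset.erase_ssubset hv
      have s2 : (A.erase v).filter (fun w => ¬ H.Adj v w) ⊂ A :=
        lt_of_le_of_lt (Finset.filter_subset _ _) s1
      have hA : IP H A = IP H (A.erase v) + X * IP H ((A.erase v).filter (fun w => ¬ H.Adj v w)) := by
        conv_lhs => rw [← Finset.insert_erase hv]
        exact IP_insert H (by simp) (by simp)
      rw [hA, ← ih _ s1, ← ih _ s2]
      conv_lhs => rw [← Finset.insert_erase hv, Finset.map_insert]
      apply IP_insert G (by simp)
      intro w
      simp only [Finset.mem_map, Finset.mem_filter]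
      constructor
      · rintro ⟨a, ⟨h1, h2⟩, rfl⟩
        exact ⟨⟨a, h1, rfl⟩, by rwa [hf]⟩
      · rintro ⟨⟨a, h1, rfl⟩, h2⟩
        exact ⟨a, ⟨h1, by rwa [hf] at h2⟩, rfl⟩

lemma IP_natDegree {V : Type*} (G : SimpleGraph V) (A : Finset V) :
    (IP G A).natDegree ≤ A.card := by
  unfold IP
  apply Polynomial.natDegree_sum_le_of_forall_le
  intro s hs
  unfold wt
  split_ifs
  · rw [natDegree_X_pow]
    exact Finset.card_le_card (Finset.mem_powerset.1 hs)
  · simp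

lemma IP_deriv {V : Type*} [DecidableEq V] (G : SimpleGraph V) (A : Finset V) (B : V → Finset V)
    (hB : ∀ v ∈ A, ∀ w, w ∈ B v ↔ w ∈ A ∧ w ≠ v ∧ ¬ G.Adj v w) (k : ℕ) :
    ((k : ℚ) + 1) * (IP G A).coeff (k + 1) = ∑ v ∈ A, (IP G (B v)).coeff k := by
  have h1 : ∀ v ∈ A, X * IP G (B v) = ∑ s ∈ A.powerset, if v ∈ s then wt G s else 0 := by
    intro v hv
    have e1 := IP_insert G (v := v) (A := A.erase v) (B := B v) (by simp)
      (by intro w; rw [hB v hv]; simp; tauto)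
    rw [Finset.insert_erase hv] at e1
    have e2 : IP G (A.erase v) = ∑ s ∈ A.powerset, if v ∈ s then 0 else wt G s := by
      unfold IP
      have : (A.erase v).powerset = A.powerset.filter (fun s => ¬ v ∈ s) := by
        ext s
        simp [Finset.subset_erase]
      rw [this, Finset.sum_filter]
      apply Finset.sum_congr rfl
      intro s _
      split_ifs <;> simp
    have e3 : IP G A = ∑ s ∈ A.powerset, (if v ∈ s then 0 else wt G s) +
        ∑ s ∈ A.powerset, (if v ∈ s then wt G s else 0) := by
      unfold IP
      rw [← Finset.sum_add_distrib]
      apply Finset.sum_congr rfl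
      intro s _
      split_ifs <;> simp
    rw [e2] at e1
    rw [e3] at e1
    exact (add_left_cancel e1).symm
  have h2 : ∑ v ∈ A, X * IP G (B v) = ∑ s ∈ A.powerset, (s.card : ℚ[X]) * wt G s := by
    rw [Finset.sum_congr rfl h1, Finset.sum_comm]
    apply Finset.sum_congr rfl
    intro s hs
    rw [Finset.mem_powerset] at hs
    rw [← Finset.sum_filter, Finset.filter_mem_eq_inter, Finset.inter_eq_right.2 hs]
    simp
  have h3 := congrArg (fun p => coeff p (k+1)) h2
  simp only [finsetSum_coeff, coeff_X_mul] at h3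
  rw [h3]
  unfold IP
  rw [finsetSum_coeff, Finset.mul_sum]
  apply Finset.sum_congr rfl
  intro s _
  rw [← C_eq_natCast, coeff_C_mul]
  unfold wt
  split_ifs
  · rw [coeff_X_pow]
    split_ifs with h
    · rw [← h]; push_cast; ring
    · simp
  · simp

lemma IP_coeff_zero {V : Type*} (G : SimpleGraph V) (A : Finset V) : (IP G A).coeff 0 = 1 := by
  classical
  unfold IP
  rw [finsetSum_coeff, Finset.sum_eq_single ∅]
  · simp [wt_empty]
  · intro s _ hs
    unfold wt
    split_ifs
    · rw [coeff_X_pow, if_neg]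
      intro h
      exact hs (Finset.card_eq_zero.1 h.symm)
    · simp
  · simp

lemma IP_coeff_one {V : Type*} (G : SimpleGraph V) (A : Finset V) : (IP G A).coeff 1 = A.card := by
  classical
  have := IP_deriv G A (fun v => A.filter (fun w => w ≠ v ∧ ¬ G.Adj v w)) (by simp) 0
  simpa [IP_coeff_zero] using this

lemma counts {W : Type*} [Fintype W] [DecidableEq W] (H : SimpleGraph W) [DecidableRel H.Adj]
    (h2 : (IP H Finset.univ).coeff 2 = (Fintype.card W : ℚ) * (Fintype.card W - 3) / 2)
    (h3 : (IP H Finset.univ).coeff 3 =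
      (Fintype.card W : ℚ) * (Fintype.card W - 4) * (Fintype.card W - 5) / 6) :
    ∑ x, (H.degree x : ℚ) = 2 * Fintype.card W ∧
    3 * ∑ x, ((H.degree x : ℚ) - 2) ^ 2 =
      ∑ x, ∑ y, ∑ z, if H.Adj x y ∧ H.Adj x z ∧ H.Adj y z then (1 : ℚ) else 0 := by
  set m : ℚ := ((Fintype.card W : ℕ) : ℚ) with hm
  set D : W → W → ℚ := fun x y => if x = y then 1 else 0 with hD
  set A : W → W → ℚ := fun x y => if H.Adj x y then 1 else 0 with hA
  have hdeg : ∀ x, ∑ y, A x y = H.degree x := by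
    intro x
    simp only [hA, Finset.sum_boole]
    rw [← H.card_neighborFinset_eq_degree]
    congr 2
    ext y; simp
  have hAs : ∀ x y, A x y = A y x := by intro x y; simp only [hA, H.adj_comm]
  have hAA : ∀ x y, A x y * A x y = A x y := by
    intro x y; simp only [hA]; split_ifs <;> simp
  have hAx : ∀ x, A x x = 0 := by intro x; simp [hA]
  have hB : ∀ x y, (if y ≠ x ∧ ¬ H.Adj x y then (1:ℚ) else 0) = 1 - (D x y + A x y) := by
    intro x y
    simp only [hD, hA]
    by_cases hxy : x = y
    · subst hxy; simp
    · by_cases ha : H.Adj x y <;> simp [hxy, ha, Ne.symm hxy]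
  have c2 := IP_deriv H Finset.univ (fun v => Finset.univ.filter (fun w => w ≠ v ∧ ¬ H.Adj v w))
    (by simp) 1
  have c3 := IP_deriv H Finset.univ (fun v => Finset.univ.filter (fun w => w ≠ v ∧ ¬ H.Adj v w))
    (by simp) 2
  have c3' : ∀ v, (2 : ℚ) * (IP H (Finset.univ.filter (fun w => w ≠ v ∧ ¬ H.Adj v w))).coeff 2 =
      ∑ y, ∑ z, (1 - (D v y + A v y)) * (1 - (D v z + A v z)) * (1 - (D y z + A y z)) := by
    intro v
    have := IP_deriv H (Finset.univ.filter (fun w => w ≠ v ∧ ¬ H.Adj v w))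
      (fun u => Finset.univ.filter (fun w => (w ≠ v ∧ ¬ H.Adj v w) ∧ (w ≠ u ∧ ¬ H.Adj u w)))
      (by simp) 1
    norm_num at this
    norm_num
    rw [this, Finset.sum_filter]
    apply Finset.sum_congr rfl
    intro y _
    rw [IP_coeff_one, Finset.card_filter]
    simp only [← hB]
    push_cast
    split_ifs with h
    · apply Finset.sum_congr rfl
      intro z _
      by_cases h1 : z ≠ v ∧ ¬ H.Adj v z <;> by_cases h2 : z ≠ y ∧ ¬ H.Adj y z <;>
        simp [h1, h2]
    · simp
  have e2 : 2 * (IP H Finset.univ).coeff 2 = ∑ x, ∑ y, (1 - (D x y + A x y)) := by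
    norm_num at c2
    rw [c2]
    apply Finset.sum_congr rfl
    intro x _
    rw [IP_coeff_one, Finset.card_filter]
    push_cast
    simp only [← hB]
  have e3 : 6 * (IP H Finset.univ).coeff 3 = ∑ x, ∑ y, ∑ z,
      (1 - (D x y + A x y)) * (1 - (D x z + A x z)) * (1 - (D y z + A y z)) := by
    simp only [← c3']
    rw [← Finset.mul_sum, ← c3]
    push_cast
    ring
  have r : ∀ x, ∑ y, (D x y + A x y) = H.degree x + 1 := by
    intro x
    rw [Finset.sum_add_distrib, hdeg]
    simp [hD, add_comm]
  have r' : ∀ x, ∑ y, (D y x + A y x) = H.degree x + 1 := by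
    intro x
    rw [← r]
    apply Finset.sum_congr rfl
    intro y _
    rw [hAs]
    simp only [hD, eq_comm]
  have f2 : 2 * (IP H Finset.univ).coeff 2 = m ^ 2 - ∑ x, ((H.degree x : ℚ) + 1) := by
    rw [e2]
    simp only [Finset.sum_sub_distrib, r]
    simp
    ring
  have t1 : ∑ x, ∑ y, ∑ z, (D x y + A x y) * (D x z + A x z) * (D y z + A y z) =
      m + 3 * ∑ x, (H.degree x : ℚ) + ∑ x, ∑ y, ∑ z, A x y * A x z * A y z := by
    have : ∀ x y z, (D x y + A x y) * (D x z + A x z) * (D y z + A y z) =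
        D x y * (D x z * D y z) + D x y * (D x z * A y z) + D x y * (A x z * D y z)
        + D x y * (A x z * A y z) +
        D x z * (A x y * D y z) + D x z * (A x y * A y z) + D y z * (A x y * A x z)
        + A x y * A x z * A y z := by intros; ring
    simp only [this, Finset.sum_add_distrib]
    congr 1
    simp [hD, hAx, hAA, hdeg, ← hAs]
    have : ∑ x, ∑ y, A x y * A y x = ∑ x, (H.degree x : ℚ) := by
      simp only [← hdeg]
      apply Finset.sum_congr rfl; intro x _
      apply Finset.sum_congr rfl; intro y _
      rw [hAs y x, hAA]
    linarith
  have f3 : 6 * (IP H Finset.univ).coeff 3 = m ^ 3 - 3 * m * ∑ x, ((H.degree x : ℚ) + 1)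
      + 3 * ∑ x, ((H.degree x : ℚ) + 1) ^ 2 -
      (m + 3 * ∑ x, (H.degree x : ℚ) + ∑ x, ∑ y, ∑ z, A x y * A x z * A y z) := by
    rw [e3, ← t1]
    have : ∀ x y z, (1 - (D x y + A x y)) * (1 - (D x z + A x z)) * (1 - (D y z + A y z)) =
        1 - (D x y + A x y) - (D x z + A x z) - (D y z + A y z)
        + (D x y + A x y) * (D x z + A x z) + (D x y + A x y) * (D y z + A y z)
        + (D x z + A x z) * (D y z + A y z)
        - (D x y + A x y) * (D x z + A x z) * (D y z + A y z) := by intros; ring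
    simp only [this]
    generalize hE : (fun x y => D x y + A x y) = E at r r'
    have hE' : ∀ x y, D x y + A x y = E x y := by intro x y; rw [← hE]
    simp only [hE'] at *
    have g1 : ∑ x, ∑ y, ∑ z, E x y * E x z = ∑ x, ((H.degree x : ℚ) + 1) ^ 2 := by
      apply Finset.sum_congr rfl; intro x _
      simp only [← Finset.mul_sum, ← Finset.sum_mul, r]; ring
    have g2 : ∑ x, ∑ y, ∑ z, E x y * E y z = ∑ x, ((H.degree x : ℚ) + 1) ^ 2 := by
      rw [Finset.sum_comm]
      apply Finset.sum_congr rfl; intro x _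
      simp only [← Finset.mul_sum, ← Finset.sum_mul, r, r']; ring
    have g3 : ∑ x, ∑ y, ∑ z, E x z * E y z = ∑ x, ((H.degree x : ℚ) + 1) ^ 2 := by
      have : ∀ x, ∑ y, ∑ z, E x z * E y z = ∑ z, ∑ y, E x z * E y z := fun x => Finset.sum_comm
      simp only [this]
      rw [Finset.sum_comm]
      apply Finset.sum_congr rfl; intro x _
      simp only [← Finset.mul_sum, ← Finset.sum_mul, r, r']; ring
    simp only [Finset.sum_sub_distrib, Finset.sum_add_distrib, g1, g2, g3, r]
    simp only [Finset.sum_const, Finset.card_univ, nsmul_eq_mul, ← hm, r, ← Finset.mul_sum,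
      Finset.sum_add_distrib]
    ring
  have hT : ∑ x, ∑ y, ∑ z, A x y * A x z * A y z =
      ∑ x, ∑ y, ∑ z, if H.Adj x y ∧ H.Adj x z ∧ H.Adj y z then (1 : ℚ) else 0 := by
    apply Finset.sum_congr rfl; intro x _
    apply Finset.sum_congr rfl; intro y _
    apply Finset.sum_congr rfl; intro z _
    simp only [hA]
    by_cases h1 : H.Adj x y <;> by_cases h2 : H.Adj x z <;> by_cases h3 : H.Adj y z <;>
      simp [h1, h2, h3]
  rw [← hT]
  generalize (∑ x, ∑ y, ∑ z, A x y * A x z * A y z) = T at *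
  have q1 : ∑ x, ((H.degree x : ℚ) + 1) = ∑ x, (H.degree x : ℚ) + m := by
    simp [Finset.sum_add_distrib, hm]
  have q2 : ∑ x, ((H.degree x : ℚ) + 1) ^ 2 = ∑ x, ((H.degree x : ℚ)) ^ 2 +
      2 * ∑ x, (H.degree x : ℚ) + m := by
    simp [Finset.sum_add_distrib, hm, add_sq, Finset.mul_sum]
  have q3 : ∑ x, ((H.degree x : ℚ) - 2) ^ 2 = ∑ x, ((H.degree x : ℚ)) ^ 2 -
      4 * ∑ x, (H.degree x : ℚ) + 4 * m := by
    simp only [sub_sq, Finset.sum_add_distrib, Finset.sum_sub_distrib, hm, Finset.mul_sum]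
    simp
    ring_nf
  have hd : ∑ x, (H.degree x : ℚ) = 2 * m := by
    rw [h2, q1] at f2; linarith
  refine ⟨hd, ?_⟩
  rw [q3, hd]
  rw [h3, q1, q2, hd] at f3
  linarith

def Good (P : ℚ[X]) : Prop :=
  ∃ (c : ℚ) (a b : ℕ), c ≠ 0 ∧ (X : ℚ[X]) ^ 4 ∣ P * (1 - X) ^ a - C c * (1 - X) ^ b

lemma good_mul {P Q : ℚ[X]} (hP : Good P) (hQ : Good Q) : Good (P * Q) := by
  obtain ⟨c, a, b, hc, u, hu⟩ := hP
  obtain ⟨c', a', b', hc', u', hu'⟩ := hQ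
  refine ⟨c * c', a + a', b + b', mul_ne_zero hc hc',
    u * (Q * (1 - X) ^ a') + C c * (1 - X) ^ b * u', ?_⟩
  have e1 : P * (1 - X) ^ a = C c * (1 - X) ^ b + X ^ 4 * u := by rw [← hu]; ring
  have e2 : Q * (1 - X) ^ a' = C c' * (1 - X) ^ b' + X ^ 4 * u' := by rw [← hu']; ring
  have : P * Q * (1 - X) ^ (a + a') = (P * (1 - X) ^ a) * (Q * (1 - X) ^ a') := by ring
  rw [this, C_mul, e1]
  conv_lhs => rw [e2]
  rw [e2]
  ring

lemma good_of_mul {P Q : ℚ[X]} (hPQ : Good (P * Q)) (hQ : Good Q) : Good P := by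
  obtain ⟨c, a, b, hc, u, hu⟩ := hPQ
  obtain ⟨c', a', b', hc', u', hu'⟩ := hQ
  refine ⟨c / c', b' + a, b + a', div_ne_zero hc hc',
    C (1 / c') * (u * (1 - X) ^ a' - P * (1 - X) ^ a * u'), ?_⟩
  have e1 : P * Q * (1 - X) ^ a = C c * (1 - X) ^ b + X ^ 4 * u := by rw [← hu]; ring
  have e2 : C c' * (1 - X) ^ b' = Q * (1 - X) ^ a' - X ^ 4 * u' := by rw [← hu']; ring
  have hcc : C c' * C (1 / c') = (1 : ℚ[X]) := by
    rw [← C_mul, mul_one_div_cancel hc', C_1]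
  have hc2 : (C (c / c') : ℚ[X]) = C c * C (1 / c') := by rw [← C_mul]; congr 1; ring
  have : P * (1 - X) ^ (b' + a) = C (1 / c') * (P * (C c' * (1 - X) ^ b') * (1 - X) ^ a) := by
    calc P * (1 - X) ^ (b' + a) = (C c' * C (1 / c')) * (P * (1 - X) ^ (b' + a)) := by
          rw [hcc, one_mul]
      _ = _ := by ring
  rw [this, e2, hc2]
  have : P * (Q * (1 - X) ^ a' - X ^ 4 * u') * (1 - X) ^ a =
    (P * Q * (1 - X) ^ a) * (1 - X) ^ a' - X ^ 4 * (P * (1 - X) ^ a * u') := by ring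
  rw [this, e1]
  ring

lemma good_C {c : ℚ} (hc : c ≠ 0) : Good (C c) := ⟨c, 0, 0, hc, by simp⟩

lemma good_pow (i : ℕ) : Good ((1 - X) ^ i) := ⟨1, 0, i, one_ne_zero, by simp⟩

lemma good_prod (s : Finset ℕ) (f : ℕ → ℚ[X]) (h : ∀ i ∈ s, Good (f i)) : Good (∏ i ∈ s, f i) := by
  classical
  induction s using Finset.induction with
  | empty => simpa using good_pow 0
  | insert i s hi ih =>
    rw [Finset.prod_insert hi]
    exact good_mul (h _ (Finset.mem_insert_self _ _))
      (ih fun j hj => h j (Finset.mem_insert_of_mem hj))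

lemma good_cyclotomic (d : ℕ) : Odd d → ¬ 3 ∣ d → Good (cyclotomic d ℚ) := by
  induction d using Nat.strong_induction_on with
  | _ d ih =>
    intro hd h3
    have hpos : 0 < d := hd.pos
    rcases Nat.lt_or_ge d 4 with h4 | h4
    · have : d = 1 := by
        rcases hd with ⟨k, hk⟩
        omega
      subst this
      have e : cyclotomic 1 ℚ = C (-1) * (1 - X) ^ 1 := by
        rw [cyclotomic_one]; simp
      rw [e]
      exact good_mul (good_C (by norm_num)) (good_pow 1)
    · apply good_of_mul (Q := ∏ i ∈ d.properDivisors, cyclotomic i ℚ)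
      · have e : cyclotomic d ℚ * ∏ i ∈ d.properDivisors, cyclotomic i ℚ = X ^ d - 1 := by
          rw [← prod_cyclotomic_eq_X_pow_sub_one hpos, ← Nat.insert_self_properDivisors hpos.ne',
            Finset.prod_insert (by simp)]
        rw [e]
        refine ⟨-1, 0, 0, by norm_num, X ^ (d - 4), ?_⟩
        rw [← pow_add, Nat.add_sub_cancel' h4]
        simp
      · apply good_prod
        intro i hi
        rw [Nat.mem_properDivisors] at hi
        exact ih i hi.2 (Odd.of_dvd_nat hd hi.1) (fun h => h3 (h.trans hi.1))

lemma good_dvd {n M : ℕ} (hd : Odd n) (h3 : ¬ 3 ∣ n) {P Q : ℚ[X]}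
    (h : P * Q = (1 - X) ^ M * (1 - X ^ n)) : Good P := by
  have hp : ∀ i ∈ n.divisors, Prime (cyclotomic i ℚ) := fun i hi =>
    (cyclotomic.irreducible_rat (Nat.pos_of_mem_divisors hi)).prime
  have h' : P * Q = (-(1 - X) ^ M) * ∏ i ∈ n.divisors, cyclotomic i ℚ := by
    rw [prod_cyclotomic_eq_X_pow_sub_one hd.pos, h]; ring
  obtain ⟨t, u, b, c, htu, -, hbc, hP, -⟩ := mul_eq_mul_prime_prod hp h'
  rw [hP]
  apply good_mul
  · have hpr : Prime (1 - X : ℚ[X]) := by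
      have : (1 - X : ℚ[X]) = -(X - C 1) := by simp
      rw [this]
      exact (prime_X_sub_C (1:ℚ)).neg
    have hb : b ∣ (1 - X) ^ M := ⟨-c, by rw [mul_neg, ← hbc]; ring⟩
    obtain ⟨i, -, w, hw⟩ := (dvd_prime_pow hpr M).1 hb
    obtain ⟨r, hr, hr2⟩ := Polynomial.isUnit_iff.1 w.isUnit
    apply good_of_mul (Q := (w : ℚ[X]))
    · rw [hw]; exact good_pow i
    · rw [← hr2]; exact good_C hr.ne_zero
  · apply good_prod
    intro i hi
    have : i ∣ n := Nat.dvd_of_mem_divisors (htu ▸ Finset.mem_union_left _ hi)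
    exact good_cyclotomic i (Odd.of_dvd_nat hd this) (fun h => h3 (h.trans this))

noncomputable def hom (N : ℕ) (p : ℚ[X]) : ℚ[X] :=
  ∑ k ∈ Finset.range (N + 1), C (p.coeff k) * X ^ k * (1 - X) ^ (2 * (N - k))

lemma hom_eval {N : ℕ} {p : ℚ[X]} (hp : p.natDegree ≤ N) {w : ℚ} (hw : w ≠ 1) :
    (hom N p).eval w = (1 - w) ^ (2 * N) * p.eval (w / (1 - w) ^ 2) := by
  have h1 : 1 - w ≠ 0 := sub_ne_zero.2 hw.symm
  unfold hom
  rw [eval_finsetSum, eval_eq_sum_range' (Nat.lt_succ_of_le hp), Finset.mul_sum]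
  apply Finset.sum_congr rfl
  intro k hk
  have hk : k ≤ N := Nat.lt_succ_iff.1 (Finset.mem_range.1 hk)
  obtain ⟨j, rfl⟩ := Nat.exists_eq_add_of_le hk
  simp only [eval_mul, eval_C, eval_pow, eval_X, eval_sub, eval_one]
  rw [Nat.add_sub_cancel_left, div_pow, ← pow_mul, mul_add, pow_add]
  field_simp

lemma eq_of_eval_ne_one {P Q : ℚ[X]} (h : ∀ w : ℚ, w ≠ 1 → P.eval w = Q.eval w) : P = Q := by
  apply eq_of_infinite_eval_eq
  apply (Set.Infinite.mono (s := {w : ℚ | w ≠ 1}))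
  · intro w hw; exact h w hw
  · exact (Set.finite_singleton (1:ℚ)).infinite_compl

lemma pow_coeffs (M : ℕ) : ∃ u : ℚ[X], (1 - X : ℚ[X]) ^ M = 1 - C (M : ℚ) * X
    + C ((M : ℚ) * (M - 1) / 2) * X ^ 2 - C ((M : ℚ) * (M - 1) * (M - 2) / 6) * X ^ 3 + X ^ 4 * u := by
  induction M with
  | zero => exact ⟨0, by simp⟩
  | succ M ih =>
    obtain ⟨u, hu⟩ := ih
    refine ⟨u * (1 - X) + C ((M : ℚ) * (M - 1) * (M - 2) / 6), ?_⟩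
    rw [pow_succ, hu]
    have h1 : (C ((M + 1 : ℕ) : ℚ) : ℚ[X]) = C (M : ℚ) + 1 := by simp
    have h2 : (C (((M + 1 : ℕ) : ℚ) * ((M + 1 : ℕ) - 1) / 2) : ℚ[X]) =
        C ((M : ℚ) * (M - 1) / 2) + C (M : ℚ) := by
      rw [← C_add]; congr 1; push_cast; ring
    have h3 : (C (((M + 1 : ℕ) : ℚ) * ((M + 1 : ℕ) - 1) * ((M + 1 : ℕ) - 2) / 6) : ℚ[X]) =
        C ((M : ℚ) * (M - 1) * (M - 2) / 6) + C ((M : ℚ) * (M - 1) / 2) := by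
      rw [← C_add]; congr 1; push_cast; ring
    rw [h1, h2, h3]
    ring

lemma low_zero {e0 e1 e2 e3 : ℚ} {v : ℚ[X]}
    (h : C e0 + C e1 * X + C e2 * X ^ 2 + C e3 * X ^ 3 = X ^ 4 * v) :
    e0 = 0 ∧ e1 = 0 ∧ e2 = 0 ∧ e3 = 0 := by
  have k0 := congrArg (fun q => coeff q 0) h
  have k1 := congrArg (fun q => coeff q 1) h
  have k2 := congrArg (fun q => coeff q 2) h
  have k3 := congrArg (fun q => coeff q 3) h
  simp only [coeff_add, coeff_C_mul, coeff_C, coeff_X, coeff_X_pow, coeff_X_pow_mul'] at k0 k1 k2 k3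
  norm_num at k0 k1 k2 k3
  exact ⟨k0, k1, k2, k3⟩

lemma low_abs {c p1 p2 p3 m0 m1 m2 m3 mb s0 s1 s2 s3 sb t0 t1 t2 t3 tb : ℚ}
    {u u0 u1 u2 u3 ub r : ℚ[X]}
    (h : (1 - C m0 * X + C s0 * X ^ 2 - C t0 * X ^ 3 + X ^ 4 * u0) +
      C p1 * X * (1 - C m1 * X + C s1 * X ^ 2 - C t1 * X ^ 3 + X ^ 4 * u1) +
      C p2 * X ^ 2 * (1 - C m2 * X + C s2 * X ^ 2 - C t2 * X ^ 3 + X ^ 4 * u2) +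
      C p3 * X ^ 3 * (1 - C m3 * X + C s3 * X ^ 2 - C t3 * X ^ 3 + X ^ 4 * u3) + X ^ 4 * r -
      C c * (1 - C mb * X + C sb * X ^ 2 - C tb * X ^ 3 + X ^ 4 * ub) = X ^ 4 * u) :
    1 - c = 0 ∧ -m0 + p1 + c * mb = 0 ∧ s0 - p1 * m1 + p2 - c * sb = 0 ∧
    -t0 + p1 * s1 - p2 * m2 + p3 + c * tb = 0 := by
  apply low_zero (v := u - u0 - C p1 * (-C t1 + X * u1) - C p2 * (C s2 - C t2 * X + X ^ 2 * u2)
    - C p3 * (- C m3 + C s3 * X - C t3 * X ^ 2 + X ^ 3 * u3) - r + C c * ub)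
  simp only [C_add, C_sub, C_mul, C_neg, C_1]
  linear_combination h

lemma coeffs_of_good {N : ℕ} (hN : 3 ≤ N) {p : ℚ[X]} (h0 : p.coeff 0 = 1) (hg : Good (hom N p)) :
    p.coeff 2 = p.coeff 1 * (p.coeff 1 - 3) / 2 ∧
    p.coeff 3 = p.coeff 1 * (p.coeff 1 - 4) * (p.coeff 1 - 5) / 6 := by
  obtain ⟨c, a, b, hc, u, hu⟩ := hg
  obtain ⟨j, rfl⟩ := Nat.exists_eq_add_of_le' hN
  obtain ⟨u0, hu0⟩ := pow_coeffs (2 * j + 6 + a)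
  obtain ⟨u1, hu1⟩ := pow_coeffs (2 * j + 4 + a)
  obtain ⟨u2, hu2⟩ := pow_coeffs (2 * j + 2 + a)
  obtain ⟨u3, hu3⟩ := pow_coeffs (2 * j + a)
  obtain ⟨ub, hub⟩ := pow_coeffs b
  have hh : ∃ r, hom (j + 3) p * (1 - X) ^ a = (1 - X) ^ (2 * j + 6 + a) +
      C (p.coeff 1) * X * (1 - X) ^ (2 * j + 4 + a) +
      C (p.coeff 2) * X ^ 2 * (1 - X) ^ (2 * j + 2 + a) +
      C (p.coeff 3) * X ^ 3 * (1 - X) ^ (2 * j + a) + X ^ 4 * r := by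
    refine ⟨(∑ k ∈ Finset.range j, C (p.coeff (k + 4)) * X ^ k * (1 - X) ^ (2 * (j + 3 - (k + 4)))) *
      (1 - X) ^ a, ?_⟩
    have e1 : 2 * (j + 3 - 0) = 2 * j + 6 := by omega
    have e2 : 2 * (j + 3 - (0 + 1)) = 2 * j + 4 := by omega
    have e3 : 2 * (j + 3 - (0 + 1 + 1)) = 2 * j + 2 := by omega
    have e4 : 2 * (j + 3 - (0 + 1 + 1 + 1)) = 2 * j := by omega
    unfold hom
    rw [Finset.sum_range_succ', Finset.sum_range_succ', Finset.sum_range_succ',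
      Finset.sum_range_succ', e1, e2, e3, e4]
    have : ∑ k ∈ Finset.range j, C (p.coeff (k + 1 + 1 + 1 + 1)) * X ^ (k + 1 + 1 + 1 + 1)
        * (1 - X) ^ (2 * (j + 3 - (k + 1 + 1 + 1 + 1))) = X ^ 4 *
        ∑ k ∈ Finset.range j, C (p.coeff (k + 4)) * X ^ k * (1 - X) ^ (2 * (j + 3 - (k + 4))) := by
      rw [Finset.mul_sum]
      apply Finset.sum_congr rfl
      intro k _
      ring
    rw [this]
    simp only [h0, zero_add, map_one]
    ring
  obtain ⟨r, hr⟩ := hh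
  rw [hr, hu0, hu1, hu2, hu3, hub] at hu
  obtain ⟨k0, k1, k2, k3⟩ := low_abs hu
  push_cast at k1 k2 k3
  have hc1 : c = 1 := by linarith
  subst hc1
  have hb : (b : ℚ) = 2 * j + 6 + a - p.coeff 1 := by linarith
  rw [hb] at k2 k3
  have h2 : p.coeff 2 = p.coeff 1 * (p.coeff 1 - 3) / 2 := by linarith
  rw [h2] at k3
  exact ⟨h2, by linarith⟩

noncomputable def J : ℕ → ℚ[X]
  | 0 => 1
  | 1 => 1 + X
  | (k + 2) => J (k + 1) + X * J k

lemma J_aeval {R : Type*} [CommRing R] [Algebra ℚ R] {a b x : R} (h1 : a + b = 1) (h2 : a * b = -x)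
    (k : ℕ) : aeval x (J (k + 2) + X * J k) = a ^ (k + 3) + b ^ (k + 3) := by
  have hb : b = 1 - a := by rw [← h1]; ring
  have hx : x = -(a * b) := by rw [h2]; ring
  induction k using Nat.twoStepInduction with
  | zero =>
    simp only [J, map_add, map_mul, aeval_X, map_one]
    rw [hx, hb]; ring
  | one =>
    simp only [J, map_add, map_mul, aeval_X, map_one]
    rw [hx, hb]; ring
  | more k ih1 ih2 =>
    have e : J (k + 2 + 2) + X * J (k + 2) =
        (J (k + 1 + 2) + X * J (k + 1)) + X * (J (k + 2) + X * J k) := by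
      rw [J, J, J]; ring
    rw [e, map_add, ih2, map_mul, ih1, aeval_X, hx, hb]
    ring

lemma path_IP {m : ℕ} (G : SimpleGraph (Fin m)) (a k : ℕ) (hk : a + k ≤ m)
    (hG : ∀ x y : Fin m, a ≤ x.val → x.val < a + k → a ≤ y.val → y.val < a + k →
      (G.Adj x y ↔ x.val + 1 = y.val ∨ y.val + 1 = x.val)) :
    IP G (Finset.univ.filter (fun x : Fin m => a ≤ x.val ∧ x.val < a + k)) = J k := by
  induction k using Nat.twoStepInduction with
  | zero =>
    have : (Finset.univ.filter (fun x : Fin m => a ≤ x.val ∧ x.val < a + 0)) = ∅ := by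
      ext x; simp
    rw [this, IP_empty, J]
  | one =>
    have : (Finset.univ.filter (fun x : Fin m => a ≤ x.val ∧ x.val < a + 1)) =
        insert (⟨a, by omega⟩ : Fin m) ∅ := by
      ext x; simp [Fin.ext_iff]; omega
    rw [this, IP_insert G (B := ∅) (by simp) (by simp), IP_empty, J]
    ring
  | more k ih1 ih2 =>
    have : (Finset.univ.filter (fun x : Fin m => a ≤ x.val ∧ x.val < a + (k + 2))) =
        insert (⟨a + k + 1, by omega⟩ : Fin m)
          (Finset.univ.filter (fun x : Fin m => a ≤ x.val ∧ x.val < a + (k + 1))) := by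
      ext x; simp [Fin.ext_iff]; omega
    rw [this, IP_insert G (B := Finset.univ.filter (fun x : Fin m => a ≤ x.val ∧ x.val < a + k))
      (by simp; omega), ih1 (by omega), ih2 (by omega), J]
    · intro x y h1 h2 h3 h4; exact hG x y h1 (by omega) h3 (by omega)
    · intro x y h1 h2 h3 h4; exact hG x y h1 (by omega) h3 (by omega)
    · intro w
      simp only [Finset.mem_filter, Finset.mem_univ, true_and]
      constructor
      · intro h
        rw [hG _ _ (by simp; omega) (by simp; omega) h.1 (by omega)]
        simp; omega
      · rintro ⟨h1, h2⟩
        rw [hG _ _ (by simp; omega) (by simp; omega) h1.1 (by omega)] at h2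
        simp at h2; omega

lemma cyc_adj {j : ℕ} (u v : Fin (j + 3)) : (cycleGraph (j + 3)).Adj u v ↔
    u.val + 1 = v.val ∨ v.val + 1 = u.val ∨ (u.val = 0 ∧ v.val = j + 2) ∨
      (v.val = 0 ∧ u.val = j + 2) := by
  have hu := u.isLt
  have hv := v.isLt
  rw [cycleGraph_adj']
  have key : ∀ u v : Fin (j + 3), (u - v).val = 1 ↔ v.val + 1 = u.val ∨ (u.val = 0 ∧ v.val = j + 2) := by
    intro u v
    have hu := u.isLt
    have hv := v.isLt
    rw [Fin.val_sub]
    rcases Nat.lt_or_ge u.val v.val with h | h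
    · rw [Nat.mod_eq_of_lt (by omega)]; omega
    · rw [Nat.mod_eq_sub_mod (by omega), Nat.mod_eq_of_lt (by omega)]; omega
  rw [key, key]
  tauto

lemma D_adj {m : ℕ} (u v : Fin m) : (Dgraph m).Adj u v ↔
    u.val + 1 = v.val ∨ v.val + 1 = u.val ∨ (u.val = 0 ∧ v.val = 2) ∨
      (v.val = 0 ∧ u.val = 2) := by
  unfold Dgraph
  rw [SimpleGraph.fromRel_adj, ne_eq, Fin.ext_iff]
  omega

lemma cyc_IP (j : ℕ) : IP (cycleGraph (j + 3)) Finset.univ = J (j + 2) + X * J j := by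
  have e : (Finset.univ : Finset (Fin (j + 3))) = insert (0 : Fin (j + 3))
      (Finset.univ.filter (fun x : Fin (j + 3) => 1 ≤ x.val ∧ x.val < 1 + (j + 2))) := by
    ext x
    have hx := x.isLt
    simp only [Finset.mem_univ, Finset.mem_insert, Finset.mem_filter, true_and, true_iff,
      Fin.ext_iff, Fin.val_zero]
    omega
  rw [e, IP_insert _ (B := Finset.univ.filter (fun x : Fin (j + 3) => 2 ≤ x.val ∧ x.val < 2 + j))
    (by simp), path_IP _ 1 (j + 2) (by omega), path_IP _ 2 j (by omega)]
  · intro x y _ _ _ _; rw [cyc_adj]; omega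
  · intro x y _ _ _ _; rw [cyc_adj]; omega
  · intro w
    simp only [Finset.mem_filter, Finset.mem_univ, true_and]
    rw [cyc_adj]
    have := w.isLt
    simp; omega

lemma D_IP (j : ℕ) : IP (Dgraph (j + 3)) Finset.univ = J (j + 2) + X * J j := by
  have e : (Finset.univ : Finset (Fin (j + 3))) = insert (0 : Fin (j + 3))
      (Finset.univ.filter (fun x : Fin (j + 3) => 1 ≤ x.val ∧ x.val < 1 + (j + 2))) := by
    ext x
    have hx := x.isLt
    simp only [Finset.mem_univ, Finset.mem_insert, Finset.mem_filter, true_and, true_iff,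
      Fin.ext_iff, Fin.val_zero]
    omega
  rw [e, IP_insert _ (B := Finset.univ.filter (fun x : Fin (j + 3) => 3 ≤ x.val ∧ x.val < 3 + j))
    (by simp), path_IP _ 1 (j + 2) (by omega), path_IP _ 3 j (by omega)]
  · intro x y _ _ _ _; rw [D_adj]; omega
  · intro x y _ _ _ _; rw [D_adj]; omega
  · intro w
    simp only [Finset.mem_filter, Finset.mem_univ, true_and]
    rw [D_adj]
    have := w.isLt
    simp; omega

lemma path_struct {W : Type*} [Fintype W] [DecidableEq W] (T : SimpleGraph W) [DecidableRel T.Adj]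
    (hT : T.Connected) (hd : ∀ x, T.degree x ≤ 2) (u : W) (hu : T.degree u ≤ 1) :
    ∃ δ : W → ℕ, δ u = 0 ∧ Function.Injective δ ∧ (∀ x, δ x < Fintype.card W) ∧
      ∀ x y, T.Adj x y ↔ δ x + 1 = δ y ∨ δ y + 1 = δ x := by
  have ha : ∀ x y, T.Adj x y → T.dist u y ≤ T.dist u x + 1 := by
    intro x y h
    have := hT.dist_triangle (u := u) (v := x) (w := y)
    rwa [dist_eq_one_iff_adj.2 h] at this
  have hb : ∀ i y, T.dist u y = i + 1 → ∃ x, T.Adj x y ∧ T.dist u x = i := by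
    intro i y hy
    obtain ⟨p, hp⟩ := hT.exists_walk_length_eq_dist y u
    rw [dist_comm, hy] at hp
    cases p with
    | nil => simp at hp
    | cons h q =>
      rename_i z
      refine ⟨z, h.symm, ?_⟩
      have h1 := dist_le q
      rw [dist_comm] at h1
      have h2 := ha _ _ h.symm
      simp at hp
      omega
  have hc : ∀ i x y, T.dist u x = i → T.dist u y = i → x = y := by
    intro i
    induction i with
    | zero =>
      intro x y hx hy
      rw [hT.dist_eq_zero_iff] at hx hy
      rw [← hx, hy]
    | succ i ih =>
      intro x y hx hy
      obtain ⟨x', hxx, hx'⟩ := hb i x hx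
      obtain ⟨y', hyy, hy'⟩ := hb i y hy
      obtain rfl := ih x' y' hx' hy'
      by_contra hne
      cases i with
      | zero =>
        rw [hT.dist_eq_zero_iff] at hx'
        subst hx'
        have : ({x, y} : Finset W) ⊆ T.neighborFinset u := by
          intro z hz
          simp at hz
          rcases hz with rfl | rfl <;> simpa
        have := Finset.card_le_card this
        rw [Finset.card_pair hne, card_neighborFinset_eq_degree] at this
        omega
      | succ k =>
        obtain ⟨w, hw, hw'⟩ := hb k x' hx'
        have : ({x, y, w} : Finset W) ⊆ T.neighborFinset x' := by
          intro z hz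
          simp at hz
          rcases hz with rfl | rfl | rfl
          · simpa
          · simpa
          · simpa using hw.symm
        have := Finset.card_le_card this
        have h1 : x ≠ w := by rintro rfl; omega
        have h2 : y ≠ w := by rintro rfl; omega
        rw [Finset.card_eq_three.2 ⟨x, y, w, hne, h1, h2, rfl⟩, card_neighborFinset_eq_degree] at this
        have := hd x'
        omega
  have hinj : Function.Injective (T.dist u) := fun x y h => hc _ x y h rfl
  refine ⟨T.dist u, by simp, hinj, ?_, ?_⟩
  · have hdown : ∀ i x, T.dist u x = i → ∀ j ≤ i, ∃ y, T.dist u y = j := by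
      intro i
      induction i with
      | zero => intro x hx j hj; exact ⟨x, by omega⟩
      | succ i ih =>
        intro x hx j hj
        rcases Nat.lt_or_ge i j with h | h
        · exact ⟨x, by omega⟩
        · obtain ⟨x', _, hx'⟩ := hb i x hx
          exact ih x' hx' j h
    intro x
    have : Finset.range (T.dist u x + 1) ⊆ Finset.univ.image (T.dist u) := by
      intro j hj
      rw [Finset.mem_range] at hj
      obtain ⟨y, hy⟩ := hdown _ x rfl j (by omega)
      exact Finset.mem_image.2 ⟨y, Finset.mem_univ _, hy⟩
    have := (Finset.card_le_card this).trans Finset.card_image_le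
    simpa using this
  · intro x y
    constructor
    · intro h
      have h1 := ha x y h
      have h2 := ha y x h.symm
      have h3 : T.dist u x ≠ T.dist u y := fun hh => h.ne (hinj hh)
      omega
    · rintro (h | h)
      · obtain ⟨z, hz, hz'⟩ := hb _ y h.symm
        rwa [← hinj hz']
      · obtain ⟨z, hz, hz'⟩ := hb _ x h.symm
        rw [← hinj hz']
        exact hz.symm

lemma iso_of_delta {W : Type*} [Fintype W] (H : SimpleGraph W) {m : ℕ} (hm : Fintype.card W = m)
    (K : SimpleGraph (Fin m)) (δ : W → ℕ) (hinj : Function.Injective δ) (hlt : ∀ x, δ x < m)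
    (h : ∀ x y, H.Adj x y ↔ K.Adj ⟨δ x, hlt x⟩ ⟨δ y, hlt y⟩) : Nonempty (H ≃g K) := by
  have hbij : Function.Bijective (fun x => (⟨δ x, hlt x⟩ : Fin m)) := by
    rw [Fintype.bijective_iff_injective_and_card]
    refine ⟨fun x y hxy => hinj (by simpa using hxy), by simp [hm]⟩
  exact ⟨⟨Equiv.ofBijective _ hbij, fun {a b} => (h a b).symm⟩⟩

lemma acyclic_aux {W : Type*} {T : SimpleGraph W} (hT : T.IsAcyclic) {x y z : W}
    (h1 : T.Adj x y) (h2 : T.Adj y z) (hxz : x ≠ z) :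
    ¬ T.Adj x z ∧ ∀ y', T.Adj x y' → T.Adj y' z → y' = y := by
  have hp : ∀ y (h1 : T.Adj x y) (h2 : T.Adj y z), (Walk.cons h1 (Walk.cons h2 Walk.nil)).IsPath := by
    intro y h1 h2
    simp [Walk.cons_isPath_iff, h1.ne, h2.ne, hxz]
  constructor
  · intro h
    have := hT.path_unique ⟨_, hp y h1 h2⟩ ⟨Walk.cons h Walk.nil, by simp [hxz]⟩
    have := congrArg (fun p : T.Path x z => p.1.length) this
    simp at this
  · intro y' h3 h4
    have := hT.path_unique ⟨_, hp y h1 h2⟩ ⟨_, hp y' h3 h4⟩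
    have := congrArg (fun p : T.Path x z => p.1.support) this
    simp at this
    exact this.symm

lemma closed_univ {W : Type*} {H : SimpleGraph W} (hH : H.Connected) (P : W → Prop) (a : W)
    (ha : P a) (hcl : ∀ x y, P x → H.Adj x y → P y) (x : W) : P x := by
  obtain ⟨p⟩ := hH.preconnected a x
  induction p with
  | nil => exact ha
  | cons h q ih => exact ih (hcl _ _ ha h)

lemma del_adj {W : Type*} (H : SimpleGraph W) (u v x y : W) :
    (H.deleteEdges {s(u, v)}).Adj x y ↔ H.Adj x y ∧ ¬ ((x = u ∧ y = v) ∨ (x = v ∧ y = u)) := by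
  simp [deleteEdges_adj]

lemma del_deg_left {W : Type*} [Fintype W] [DecidableEq W] (H T : SimpleGraph W)
    [DecidableRel H.Adj] [DecidableRel T.Adj] {u v : W}
    (hT : T = H.deleteEdges {s(u, v)}) (huv : H.Adj u v) : T.degree u + 1 = H.degree u := by
  have : T.neighborFinset u = (H.neighborFinset u).erase v := by
    ext z
    rw [mem_neighborFinset, hT, del_adj, Finset.mem_erase, mem_neighborFinset]
    have := huv.ne
    constructor
    · rintro ⟨h1, h2⟩
      exact ⟨fun h => h2 (Or.inl ⟨rfl, h⟩), h1⟩
    · rintro ⟨h1, h2⟩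
      refine ⟨h2, ?_⟩
      rintro (h | h)
      · exact h1 h.2
      · exact this h.1
  rw [← card_neighborFinset_eq_degree, this, Finset.card_erase_of_mem (by simpa),
    card_neighborFinset_eq_degree]
  have : 0 < H.degree u := by rw [H.degree_pos_iff_exists_adj]; exact ⟨v, huv⟩
  omega

lemma del_deg {W : Type*} [Fintype W] [DecidableEq W] (H T : SimpleGraph W)
    [DecidableRel H.Adj] [DecidableRel T.Adj] {u v : W}
    (hT : T = H.deleteEdges {s(u, v)}) (x : W) : T.degree x ≤ H.degree x :=
  degree_le_of_le (hT ▸ deleteEdges_le _)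

lemma edge_card {W : Type*} [Fintype W] [DecidableEq W] (H : SimpleGraph W) [DecidableRel H.Adj]
    (hs : ∑ x, H.degree x = 2 * Fintype.card W) : Nat.card H.edgeSet = Fintype.card W := by
  rw [sum_degrees_eq_twice_card_edges] at hs
  rw [Nat.card_eq_fintype_card, ← edgeFinset_card]
  omega

lemma edge_card_del {W : Type*} [Fintype W] [DecidableEq W] (H : SimpleGraph W) [DecidableRel H.Adj]
    (hs : ∑ x, H.degree x = 2 * Fintype.card W) {u v : W} (huv : H.Adj u v) :
    Nat.card (H.deleteEdges {s(u, v)}).edgeSet + 1 = Nat.card W := by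
  have h1 := edge_card H hs
  rw [Nat.card_coe_set_eq] at h1 ⊢
  rw [edgeSet_deleteEdges]
  have := Set.ncard_diff_singleton_add_one (s := H.edgeSet) (a := s(u,v)) huv (Set.toFinite _)
  rw [this, h1, Nat.card_eq_fintype_card]

lemma cycle_case {W : Type*} [Fintype W] [DecidableEq W] (H : SimpleGraph W) [DecidableRel H.Adj]
    (hH : H.Connected) (hd : ∀ x, H.degree x = 2) :
    ∃ j, Fintype.card W = j + 3 ∧ Nonempty (H ≃g cycleGraph (j + 3)) := by
  classical
  have hs : ∑ x, H.degree x = 2 * Fintype.card W := by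
    simp [hd, mul_comm]
  have hec := edge_card H hs
  have hna : ¬ H.IsAcyclic := by
    intro h
    have := (isTree_iff_connected_and_card.1 ⟨hH, h⟩).2
    rw [hec, Nat.card_eq_fintype_card] at this
    omega
  rw [isAcyclic_iff_forall_adj_isBridge] at hna
  push Not at hna
  obtain ⟨u, v, huv, hb⟩ := hna
  obtain ⟨T, hT⟩ : ∃ T, T = H.deleteEdges {s(u, v)} := ⟨_, rfl⟩
  have hTc : T.Connected := by
    rw [hT]; exact hH.connected_delete_edge_of_not_isBridge hb
  have hu := del_deg_left H T hT huv
  have hv := del_deg_left H T (u := v) (v := u) (by rw [hT, Sym2.eq_swap]) huv.symm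
  rw [hd] at hu hv
  obtain ⟨δ, hδu, hinj, hlt, hadj⟩ := path_struct T hTc
    (fun x => (del_deg H T hT x).trans (hd x).le) u (by omega)
  have hm : 3 ≤ Fintype.card W := by
    have := H.degree_lt_card_verts u
    rw [hd] at this
    omega
  obtain ⟨j, hj⟩ := Nat.exists_eq_add_of_le' hm
  rw [hj] at hlt
  have hsurj : ∀ i < j + 3, ∃ x, δ x = i := by
    intro i hi
    have hbij : Function.Bijective (fun x => (⟨δ x, hlt x⟩ : Fin (j+3))) := by
      rw [Fintype.bijective_iff_injective_and_card]
      refine ⟨fun x y hxy => hinj (by simpa using hxy), by simp [hj]⟩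
    obtain ⟨x, hx⟩ := hbij.2 ⟨i, hi⟩
    exact ⟨x, by simpa using hx⟩
  have hδv : δ v = j + 2 := by
    by_contra hne
    have h1 := hlt v
    obtain ⟨z, hz⟩ := hsurj (δ v + 1) (by omega)
    have h0 : δ v ≠ 0 := fun h => huv.ne (hinj (by rw [hδu, h]))
    obtain ⟨w, hw⟩ := hsurj (δ v - 1) (by omega)
    have hzw : z ≠ w := by rintro rfl; omega
    have : ({z, w} : Finset W) ⊆ T.neighborFinset v := by
      intro t ht
      simp only [Finset.mem_insert, Finset.mem_singleton] at ht
      rw [mem_neighborFinset, hadj]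
      rcases ht with rfl | rfl <;> omega
    have := Finset.card_le_card this
    rw [Finset.card_pair hzw, card_neighborFinset_eq_degree] at this
    omega
  refine ⟨j, hj, iso_of_delta H hj _ δ hinj hlt ?_⟩
  intro x y
  rw [cyc_adj]
  have hxu : δ x = 0 ↔ x = u := ⟨fun h => hinj (by rw [h, hδu]), fun h => by rw [h, hδu]⟩
  have hyu : δ y = 0 ↔ y = u := ⟨fun h => hinj (by rw [h, hδu]), fun h => by rw [h, hδu]⟩
  have hxv : δ x = j + 2 ↔ x = v := ⟨fun h => hinj (by rw [h, hδv]), fun h => by rw [h, hδv]⟩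
  have hyv : δ y = j + 2 ↔ y = v := ⟨fun h => hinj (by rw [h, hδv]), fun h => by rw [h, hδv]⟩
  simp only
  rw [hxu, hyu, hxv, hyv, ← or_assoc, ← hadj, hT, del_adj]
  by_cases hc : (x = u ∧ y = v) ∨ (x = v ∧ y = u)
  · have : H.Adj x y := by
      rcases hc with ⟨rfl, rfl⟩ | ⟨rfl, rfl⟩
      · exact huv
      · exact huv.symm
    tauto
  · tauto

set_option maxHeartbeats 1000000 in
lemma tri_case {W : Type*} [Fintype W] [DecidableEq W] (H : SimpleGraph W) [DecidableRel H.Adj]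
    (hH : H.Connected) (hs : ∑ x, H.degree x = 2 * Fintype.card W)
    (hq : 3 * ∑ x, ((H.degree x : ℚ) - 2) ^ 2 =
      ∑ x, ∑ y, ∑ z, if H.Adj x y ∧ H.Adj x z ∧ H.Adj y z then (1 : ℚ) else 0)
    {a b c : W} (hab : H.Adj a b) (hbc : H.Adj b c) (hac : H.Adj a c) (hc3 : 3 ≤ H.degree c) :
    ∃ j, Fintype.card W = j + 3 ∧ Nonempty (H ≃g Dgraph (j + 3)) := by
  classical
  obtain ⟨T, hT⟩ : ∃ T, T = H.deleteEdges {s(a, c)} := ⟨_, rfl⟩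
  have hTa : ∀ x y, T.Adj x y ↔ H.Adj x y ∧ ¬ ((x = a ∧ y = c) ∨ (x = c ∧ y = a)) := by
    intro x y; rw [hT, del_adj]
  have nab := hab.ne
  have nbc := hbc.ne
  have nac := hac.ne
  have hTab : T.Adj a b := by
    rw [hTa]; refine ⟨hab, ?_⟩; rintro (h | h)
    · exact nbc h.2
    · exact nab h.2.symm
  have hTbc : T.Adj b c := by
    rw [hTa]; refine ⟨hbc, ?_⟩; rintro (h | h)
    · exact nab h.1.symm
    · exact nbc h.1
  have hTc : T.Connected := by
    rw [hT]
    apply hH.connected_delete_edge_of_not_isBridge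
    rw [isBridge_iff, not_not, ← hT]
    exact hTab.reachable.trans hTbc.reachable
  have hTacy : T.IsAcyclic := by
    have := edge_card_del H hs hac
    rw [← hT] at this
    exact (isTree_iff_connected_and_card.2 ⟨hTc, this⟩).2
  have huniq : ∀ z, H.Adj a z → H.Adj c z → z = b := by
    intro z h1 h2
    apply (acyclic_aux hTacy hTab hTbc nac).2 z
    · rw [hTa]; refine ⟨h1, ?_⟩; rintro (h | h)
      · exact h2.ne h.2.symm
      · exact h1.ne h.2.symm
    · rw [hTa]; refine ⟨h2.symm, ?_⟩; rintro (h | h)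
      · exact h1.ne h.1.symm
      · exact h2.ne h.1.symm
  have htri : ∀ x y z, H.Adj x y → H.Adj x z → H.Adj y z →
      (x = a ∧ y = b ∧ z = c) ∨ (x = a ∧ y = c ∧ z = b) ∨ (x = b ∧ y = a ∧ z = c) ∨
      (x = b ∧ y = c ∧ z = a) ∨ (x = c ∧ y = a ∧ z = b) ∨ (x = c ∧ y = b ∧ z = a) := by
    intro x y z h1 h2 h3
    by_cases e1 : (x = a ∧ y = c) ∨ (x = c ∧ y = a)
    · rcases e1 with ⟨rfl, rfl⟩ | ⟨rfl, rfl⟩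
      · have h9 := huniq z h2 h3; clear huniq hTa; simp [h9]
      · have h9 := huniq z h3 h2; clear huniq hTa; simp [h9]
    by_cases e2 : (x = a ∧ z = c) ∨ (x = c ∧ z = a)
    · rcases e2 with ⟨rfl, rfl⟩ | ⟨rfl, rfl⟩
      · have h9 := huniq y h1 h3.symm; clear huniq hTa; simp [h9]
      · have h9 := huniq y h3.symm h1; clear huniq hTa; simp [h9]
    by_cases e3 : (y = a ∧ z = c) ∨ (y = c ∧ z = a)
    · rcases e3 with ⟨rfl, rfl⟩ | ⟨rfl, rfl⟩
      · have h9 := huniq x h1.symm h2.symm; clear huniq hTa; simp [h9]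
      · have h9 := huniq x h2.symm h1.symm; clear huniq hTa; simp [h9]
    exfalso
    exact (acyclic_aux hTacy ((hTa _ _).2 ⟨h1, e1⟩) ((hTa _ _).2 ⟨h3, e3⟩) h2.ne).1
      ((hTa _ _).2 ⟨h2, e2⟩)
  obtain ⟨g, hg⟩ : ∃ g : W → W → W → W → W → W → ℚ, g = fun p q r x y z =>
    if x = p then (if y = q then (if z = r then 1 else 0) else 0) else 0 := ⟨_, rfl⟩
  have hg1 : ∀ p q r, ∑ x, ∑ y, ∑ z, g p q r x y z = 1 := by
    intro p q r
    rw [Finset.sum_eq_single p, Finset.sum_eq_single q, Finset.sum_eq_single r]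
    · simp [hg]
    · intro z _ hz; simp [hg, hz]
    · simp
    · intro z _ hz; simp [hg, hz]
    · simp
    · intro z _ hz; simp [hg, hz]
    · simp
  have hg0 : ∀ p q r x y z, 0 ≤ g p q r x y z := by
    intro p q r x y z
    rw [hg]; dsimp only; split_ifs <;> norm_num
  have hgs : ∀ p q r, g p q r p q r = 1 := by intro p q r; simp [hg]
  have h6 : (∑ x, ∑ y, ∑ z, if H.Adj x y ∧ H.Adj x z ∧ H.Adj y z then (1 : ℚ) else 0) ≤ 6 := by
    calc _ ≤ ∑ x, ∑ y, ∑ z, (g a b c x y z + g a c b x y z + g b a c x y z + g b c a x y z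
          + g c a b x y z + g c b a x y z) := by
          refine Finset.sum_le_sum fun x _ => Finset.sum_le_sum fun y _ => Finset.sum_le_sum fun z _ => ?_
          have k1 := hg0 a b c x y z
          have k2 := hg0 a c b x y z
          have k3 := hg0 b a c x y z
          have k4 := hg0 b c a x y z
          have k5 := hg0 c a b x y z
          have k6 := hg0 c b a x y z
          split_ifs with h
          · rcases htri x y z h.1 h.2.1 h.2.2 with ⟨rfl, rfl, rfl⟩ | ⟨rfl, rfl, rfl⟩ | ⟨rfl, rfl, rfl⟩ |
              ⟨rfl, rfl, rfl⟩ | ⟨rfl, rfl, rfl⟩ | ⟨rfl, rfl, rfl⟩ <;>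
            · have := hgs x y z
              linarith
          · linarith
      _ = 6 := by
          simp only [Finset.sum_add_distrib, hg1]; norm_num
  have hsq : ∑ x, ((H.degree x : ℤ) - 2) * ((H.degree x : ℤ) - 1) ≤ 2 := by
    have e1 : ∑ x, (((H.degree x : ℤ) - 2) * ((H.degree x : ℤ) - 1)) =
        ∑ x, ((H.degree x : ℤ) - 2) ^ 2 + ∑ x, ((H.degree x : ℤ) - 2) := by
      rw [← Finset.sum_add_distrib]
      exact Finset.sum_congr rfl fun x _ => by ring
    have e2 : ∑ x, ((H.degree x : ℤ) - 2) = 0 := by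
      rw [Finset.sum_sub_distrib, ← Nat.cast_sum, hs]
      simp; ring
    have e3 : ∑ x, ((H.degree x : ℤ) - 2) ^ 2 ≤ 2 := by
      have : ∑ x, ((H.degree x : ℚ) - 2) ^ 2 ≤ 2 := by linarith
      exact_mod_cast this
    rw [e1, e2]; linarith
  have hnn : ∀ x, 0 ≤ ((H.degree x : ℤ) - 2) * ((H.degree x : ℤ) - 1) := by
    intro x
    rcases le_or_gt (H.degree x : ℤ) 1 with h | h
    · nlinarith
    · nlinarith
  have hc3' : (3 : ℤ) ≤ H.degree c := by exact_mod_cast hc3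
  have hdo : ∀ x, x ≠ c → H.degree x ≤ 2 := by
    intro x hx
    have h1 : ∑ y ∈ {x, c}, ((H.degree y : ℤ) - 2) * ((H.degree y : ℤ) - 1) ≤ 2 :=
      (Finset.sum_le_sum_of_subset_of_nonneg (Finset.subset_univ _) fun y _ _ => hnn y).trans hsq
    rw [Finset.sum_pair hx] at h1
    by_contra hcon
    have h2 : (3 : ℤ) ≤ H.degree x := by exact_mod_cast (by omega : 3 ≤ H.degree x)
    nlinarith
  have hdc : H.degree c = 3 := by
    have h1 : ((H.degree c : ℤ) - 2) * ((H.degree c : ℤ) - 1) ≤ 2 :=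
      (Finset.single_le_sum (fun y _ => hnn y) (Finset.mem_univ c)).trans hsq
    by_contra hcon
    have h2 : (4 : ℤ) ≤ H.degree c := by exact_mod_cast (by omega : 4 ≤ H.degree c)
    nlinarith
  have ta := del_deg_left H T hT hac
  have tc := del_deg_left H T (u := c) (v := a) (by rw [hT, Sym2.eq_swap]) hac.symm
  have hda := hdo a nac
  obtain ⟨δ, hδa, hinj, hlt, hadj⟩ := path_struct T hTc
    (fun x => by
      by_cases hx : x = c
      · subst hx; omega
      · exact (del_deg H T hT x).trans (hdo x hx)) a (by omega)
  have hδb : δ b = 1 := by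
    have := (hadj a b).1 hTab
    omega
  have hδc : δ c = 2 := by
    have := (hadj b c).1 hTbc
    have h2 : δ c ≠ δ a := fun h => nac (hinj h.symm)
    omega
  have hm : 3 ≤ Fintype.card W := by
    have := hlt c
    omega
  obtain ⟨j, hj⟩ := Nat.exists_eq_add_of_le' hm
  rw [hj] at hlt
  refine ⟨j, hj, iso_of_delta H hj _ δ hinj hlt ?_⟩
  intro x y
  rw [D_adj]
  have hxu : δ x = 0 ↔ x = a := ⟨fun h => hinj (by rw [h, hδa]), fun h => by rw [h, hδa]⟩
  have hyu : δ y = 0 ↔ y = a := ⟨fun h => hinj (by rw [h, hδa]), fun h => by rw [h, hδa]⟩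
  have hxv : δ x = 2 ↔ x = c := ⟨fun h => hinj (by rw [h, hδc]), fun h => by rw [h, hδc]⟩
  have hyv : δ y = 2 ↔ y = c := ⟨fun h => hinj (by rw [h, hδc]), fun h => by rw [h, hδc]⟩
  simp only
  rw [hxu, hyu, hxv, hyv, ← or_assoc, ← hadj, hTa]
  clear hTa hadj huniq htri hg hg0 hg1 hgs h6 hq hsq hnn hdo hTacy hTc hxu hyu hxv hyv hlt hinj
  by_cases hc : (x = a ∧ y = c) ∨ (x = c ∧ y = a)
  · have : H.Adj x y := by
      rcases hc with ⟨rfl, rfl⟩ | ⟨rfl, rfl⟩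
      · exact hac
      · exact hac.symm
    rcases hc with ⟨rfl, rfl⟩ | ⟨rfl, rfl⟩ <;> simp [this]
  · have hc' : ¬ ((x = a ∧ y = c) ∨ (y = a ∧ x = c)) := fun h => hc (by
      rcases h with h | h
      · exact Or.inl h
      · exact Or.inr h.symm)
    simp only [hc, hc', or_false, not_false_eq_true, and_true]

lemma structure_thm {W : Type*} [Fintype W] [DecidableEq W] (H : SimpleGraph W) [DecidableRel H.Adj]
    (hH : H.Connected) (hs : ∑ x, (H.degree x : ℚ) = 2 * Fintype.card W)
    (hq : 3 * ∑ x, ((H.degree x : ℚ) - 2) ^ 2 =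
      ∑ x, ∑ y, ∑ z, if H.Adj x y ∧ H.Adj x z ∧ H.Adj y z then (1 : ℚ) else 0) :
    ∃ j, Fintype.card W = j + 3 ∧
      (Nonempty (H ≃g cycleGraph (j + 3)) ∨ Nonempty (H ≃g Dgraph (j + 3))) := by
  have hs' : ∑ x, H.degree x = 2 * Fintype.card W := by exact_mod_cast hs
  have hcyc : (∀ x, H.degree x = 2) → ∃ j, Fintype.card W = j + 3 ∧
      (Nonempty (H ≃g cycleGraph (j + 3)) ∨ Nonempty (H ≃g Dgraph (j + 3))) := by
    intro h
    obtain ⟨j, h1, h2⟩ := cycle_case H hH h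
    exact ⟨j, h1, Or.inl h2⟩
  by_cases ht : ∃ a b c, H.Adj a b ∧ H.Adj b c ∧ H.Adj a c
  · obtain ⟨a, b, c, hab, hbc, hac⟩ := ht
    by_cases hc : 3 ≤ H.degree c
    · obtain ⟨j, h1, h2⟩ := tri_case H hH hs' hq hab hbc hac hc
      exact ⟨j, h1, Or.inr h2⟩
    by_cases hb : 3 ≤ H.degree b
    · obtain ⟨j, h1, h2⟩ := tri_case H hH hs' hq hac hbc.symm hab hb
      exact ⟨j, h1, Or.inr h2⟩
    by_cases ha : 3 ≤ H.degree a
    · obtain ⟨j, h1, h2⟩ := tri_case H hH hs' hq hbc hac.symm hab.symm ha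
      exact ⟨j, h1, Or.inr h2⟩
    apply hcyc
    have key : ∀ x y z, H.Adj x y → H.Adj x z → y ≠ z → ¬ 3 ≤ H.degree x →
        H.degree x = 2 ∧ ∀ t, H.Adj x t → t = y ∨ t = z := by
      intro x y z h1 h2 hne hx
      have hsub : ({y, z} : Finset W) ⊆ H.neighborFinset x := by
        intro t ht
        simp only [Finset.mem_insert, Finset.mem_singleton] at ht
        rw [mem_neighborFinset]
        rcases ht with rfl | rfl <;> assumption
      have hcard := Finset.card_le_card hsub
      rw [Finset.card_pair hne, card_neighborFinset_eq_degree] at hcard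
      refine ⟨by omega, ?_⟩
      have := Finset.eq_of_subset_of_card_le hsub
        (by rw [Finset.card_pair hne, card_neighborFinset_eq_degree]; omega)
      intro t ht
      have ht' : t ∈ H.neighborFinset x := by simpa
      rw [← this] at ht'
      simpa using ht'
    have ka := key a b c hab hac hbc.ne ha
    have kb := key b a c hab.symm hbc hac.ne hb
    have kc := key c a b hac.symm hbc.symm hab.ne hc
    have hall := closed_univ hH (fun x => x = a ∨ x = b ∨ x = c) a (Or.inl rfl) (by
      rintro x y (rfl | rfl | rfl) h
      · have := ka.2 y h; tauto
      · have := kb.2 y h; tauto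
      · have := kc.2 y h; tauto)
    intro x
    rcases hall x with rfl | rfl | rfl
    · exact ka.1
    · exact kb.1
    · exact kc.1
  · apply hcyc
    have h0 : (∑ x, ∑ y, ∑ z, if H.Adj x y ∧ H.Adj x z ∧ H.Adj y z then (1 : ℚ) else 0) = 0 := by
      refine Finset.sum_eq_zero fun x _ => Finset.sum_eq_zero fun y _ => Finset.sum_eq_zero fun z _ => ?_
      rw [if_neg]
      rintro ⟨h1, h2, h3⟩
      exact ht ⟨x, y, z, h1, h3, h2⟩
    rw [h0] at hq
    have h1 : ∑ x, ((H.degree x : ℚ) - 2) ^ 2 = 0 := by linarith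
    rw [Finset.sum_eq_zero_iff_of_nonneg (fun x _ => sq_nonneg _)] at h1
    intro x
    have := h1 x (Finset.mem_univ x)
    have h2 : (H.degree x : ℚ) = 2 := by
      have := pow_eq_zero_iff (two_ne_zero) |>.1 this
      linarith
    exact_mod_cast h2

lemma vanish_iff {n : ℕ} (hn : 4 ≤ n) (hodd : Odd n) {ω : ℂ} (hω : IsPrimitiveRoot ω n) (k : ℕ) :
    (aeval (ω / (1 - ω) ^ 2) (J (k + 2) + X * J k) = 0 → n ∣ k + 3) ∧
    (n = k + 3 → aeval (ω / (1 - ω) ^ 2) (J (k + 2) + X * J k) = 0) := by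
  have h1 : (1 : ℂ) - ω ≠ 0 := sub_ne_zero.2 (hω.ne_one (by omega)).symm
  rw [J_aeval (a := 1 / (1 - ω)) (b := -ω / (1 - ω)) (by field_simp; ring) (by field_simp)]
  have e : (1 / (1 - ω)) ^ (k + 3) + (-ω / (1 - ω)) ^ (k + 3) =
      (1 + (-ω) ^ (k + 3)) / (1 - ω) ^ (k + 3) := by
    rw [div_pow, div_pow, one_pow, add_div]
  rw [e, div_eq_zero_iff, or_iff_left (pow_ne_zero _ h1)]
  constructor
  · intro h
    have h2 : (-ω) ^ (k + 3) = -1 := by linear_combination h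
    have h3 : ω ^ (2 * (k + 3)) = 1 := by
      have : ω ^ (2 * (k + 3)) = ((-ω) ^ (k + 3)) ^ 2 := by
        rw [← pow_mul, mul_comm (k + 3) 2, pow_mul, pow_mul, neg_sq]
      rw [this, h2]; norm_num
    have h4 := hω.dvd_of_pow_eq_one _ h3
    exact (Nat.Coprime.dvd_of_dvd_mul_left hodd.coprime_two_right h4)
  · intro h
    rw [← h, hodd.neg_pow, hω.pow_eq_one]; ring

lemma hom_prod {n j : ℕ} (hj : n = j + 3) (hodd : Odd n) {p q : ℚ[X]} (hp : p.natDegree ≤ n) (hq : q.natDegree ≤ n)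
    (h : p * q = J (j + 2) + X * J j) : hom n p * hom n q = (1 - X) ^ (3 * n) * (1 - X ^ n) := by
  apply eq_of_eval_ne_one
  intro w hw
  have h1 : 1 - w ≠ 0 := sub_ne_zero.2 hw.symm
  have h2 := J_aeval (a := 1 / (1 - w)) (b := -w / (1 - w)) (x := w / (1 - w) ^ 2)
    (by field_simp; ring) (by field_simp) j
  rw [← h, coe_aeval_eq_eval, eval_mul, ← hj] at h2
  rw [eval_mul, hom_eval hp hw, hom_eval hq hw]
  have h3 : (1 - w) ^ (2 * n) * p.eval (w / (1 - w) ^ 2) * ((1 - w) ^ (2 * n) * q.eval (w / (1 - w) ^ 2))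
    = (1 - w) ^ (3 * n) * ((1 - w) ^ n * (p.eval (w / (1 - w) ^ 2) * q.eval (w / (1 - w) ^ 2))) := by ring
  rw [h3, h2]
  have h4 : (1 - w) ^ n ≠ 0 := pow_ne_zero _ h1
  simp only [eval_mul, eval_pow, eval_sub, eval_one, eval_X]
  rw [div_pow, div_pow, hodd.neg_pow, one_pow]
  field_simp
  ring

lemma IP_iso {V W : Type*} [Fintype V] [Fintype W] {G : SimpleGraph V} {H : SimpleGraph W} (e : H ≃g G) :
    IP G Finset.univ = IP H Finset.univ := by
  rw [← IP_map G H e.toEquiv.toEmbedding (fun a b => e.map_rel_iff) Finset.univ]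
  congr 1
  ext x
  simp only [Finset.mem_univ, Finset.mem_map, true_and, true_iff]
  exact ⟨e.symm x, by simp⟩

lemma main {n : ℕ} (hn : 4 ≤ n) (hodd : Odd n)
    (h3 : ¬ (3 ∣ n)) {V : Type} [Fintype V] (G : SimpleGraph V)
    (h : G.indepPoly = (cycleGraph n).indepPoly) :
    Nonempty (G ≃g cycleGraph n) ∨ Nonempty (G ≃g Dgraph n) := by
  classical
  rw [IP_univ, IP_univ] at h
  have hcard : Fintype.card V = n := by
    have := congrArg (fun p => p.coeff 1) h
    simp only [IP_coeff_one, Finset.card_univ, Fintype.card_fin] at this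
    exact_mod_cast this
  obtain ⟨j, hj⟩ := Nat.exists_eq_add_of_le' (by omega : 3 ≤ n)
  have hJ : IP G Finset.univ = J (j + 2) + X * J j := by
    rw [h]; subst hj; exact cyc_IP j
  obtain ⟨ω, hω⟩ : ∃ ω : ℂ, IsPrimitiveRoot ω n := ⟨_, Complex.isPrimitiveRoot_exp n (by omega)⟩
  obtain ⟨x0, hx0⟩ : ∃ x0 : ℂ, x0 = ω / (1 - ω) ^ 2 := ⟨_, rfl⟩
  have hv := vanish_iff hn hodd hω
  rw [← hx0] at hv
  obtain ⟨S, ⟨hScl, hS0⟩, hmin⟩ : ∃ S : Finset V, ((∀ x ∈ S, ∀ y, y ∉ S → ¬ G.Adj x y) ∧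
      aeval x0 (IP G S) = 0) ∧ ∀ A : Finset V, ((∀ x ∈ A, ∀ y, y ∉ A → ¬ G.Adj x y) ∧
      aeval x0 (IP G A) = 0) → S.card ≤ A.card := by
    obtain ⟨S, hS, hm⟩ := Finset.exists_min_image (Finset.univ.filter (fun A : Finset V =>
      (∀ x ∈ A, ∀ y, y ∉ A → ¬ G.Adj x y) ∧ aeval x0 (IP G A) = 0)) Finset.card
      ⟨Finset.univ, by
        rw [Finset.mem_filter]
        refine ⟨Finset.mem_univ _, by simp, ?_⟩
        rw [hJ]; exact (hv j).2 hj⟩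
    exact ⟨S, (Finset.mem_filter.1 hS).2, fun A hA => hm A (Finset.mem_filter.2 ⟨Finset.mem_univ _, hA⟩)⟩
  have hSne : S.Nonempty := by
    rw [Finset.nonempty_iff_ne_empty]
    rintro rfl
    simp [IP_empty] at hS0
  obtain ⟨H, hH⟩ : ∃ H : SimpleGraph S, H = G.comap (Subtype.val : S → V) := ⟨_, rfl⟩
  have hHadj : ∀ a b : S, G.Adj a b ↔ H.Adj a b := by intro a b; rw [hH]; rfl
  have hIPH : IP G S = IP H Finset.univ := by
    rw [← IP_map G H (Function.Embedding.subtype (· ∈ S)) hHadj Finset.univ]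
    congr 1
    ext x; simp
  have hconn : H.Connected := by
    obtain ⟨u, hu⟩ := hSne
    by_contra hnc
    have : ∃ v : S, ¬ H.Reachable ⟨u, hu⟩ v := by
      by_contra hall
      push Not at hall
      haveI : Nonempty S := ⟨⟨u, hu⟩⟩
      exact hnc ⟨fun a b => (hall a).symm.trans (hall b)⟩
    obtain ⟨v, hv'⟩ := this
    obtain ⟨A, hA⟩ : ∃ A : Finset V, A = S.filter (fun x => ∃ hx : x ∈ S, H.Reachable ⟨u, hu⟩ ⟨x, hx⟩) :=
      ⟨_, rfl⟩
    have hAS : A ⊆ S := by rw [hA]; exact Finset.filter_subset _ _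
    have hmA : ∀ x (hx : x ∈ S), x ∈ A ↔ H.Reachable ⟨u, hu⟩ ⟨x, hx⟩ := by
      intro x hx; rw [hA]; simp [hx]
    have hno : ∀ a ∈ A, ∀ b ∈ S \ A, ¬ G.Adj a b := by
      intro a ha b hb hab
      rw [Finset.mem_sdiff] at hb
      apply hb.2
      rw [hmA b hb.1]
      exact ((hmA a (hAS ha)).1 ha).trans
        (((hHadj ⟨a, hAS ha⟩ ⟨b, hb.1⟩).1 hab).reachable)
    have hprod := IP_mul G (S \ A) A Finset.disjoint_sdiff hno
    rw [Finset.union_sdiff_of_subset hAS] at hprod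
    rw [hprod, map_mul, mul_eq_zero] at hS0
    rcases hS0 with h0 | h0
    · have := hmin A ⟨?_, h0⟩
      · have hlt : A.card < S.card := Finset.card_lt_card (by
          rw [Finset.ssubset_iff_of_subset hAS]
          exact ⟨v, v.2, fun h => hv' ((hmA v v.2).1 h)⟩)
        omega
      · intro x hx y hy
        by_cases hyS : y ∈ S
        · exact hno x hx y (Finset.mem_sdiff.2 ⟨hyS, hy⟩)
        · exact hScl x (hAS hx) y hyS
    · have := hmin (S \ A) ⟨?_, h0⟩
      · have hlt : (S \ A).card < S.card := Finset.card_lt_card (by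
          rw [Finset.ssubset_iff_of_subset Finset.sdiff_subset]
          refine ⟨u, hu, fun h => (Finset.mem_sdiff.1 h).2 ((hmA u hu).2 (Reachable.refl _))⟩)
        omega
      · intro x hx y hy
        by_cases hyA : y ∈ A
        · exact fun hxy => hno y hyA x hx hxy.symm
        · refine hScl x (Finset.mem_sdiff.1 hx).1 y (fun hyS => hy (Finset.mem_sdiff.2 ⟨hyS, hyA⟩))
  have hSn : S.card ≤ n := by rw [← hcard]; exact Finset.card_le_univ S
  have hprod : IP G S * IP G Sᶜ = J (j + 2) + X * J j := by
    rw [← hJ, ← IP_mul G Sᶜ S disjoint_compl_right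
      (fun a ha b hb => hScl a ha b (Finset.mem_compl.1 hb)), Finset.union_compl]
  have hgood := good_dvd hodd h3 (hom_prod hj hodd ((IP_natDegree G S).trans hSn)
    ((IP_natDegree G Sᶜ).trans ((Finset.card_le_univ _).trans hcard.le)) hprod)
  have hco := coeffs_of_good (by omega) (IP_coeff_zero G S) hgood
  rw [IP_coeff_one, hIPH] at hco
  have hcS : Fintype.card S = S.card := Fintype.card_coe S
  have hcnt := counts H (by rw [hcS]; exact hco.1) (by rw [hcS]; exact hco.2)
  obtain ⟨k, hk, hiso⟩ := structure_thm H hconn hcnt.1 hcnt.2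
  have hIPk : IP G S = J (k + 2) + X * J k := by
    rw [hIPH]
    rcases hiso with he | he
    · rw [← IP_iso he.some, cyc_IP]
    · rw [← IP_iso he.some, D_IP]
  rw [hIPk] at hS0
  have hdvd := (hv k).1 hS0
  have hkn : k + 3 = n := by
    have := Nat.le_of_dvd (by omega) hdvd
    omega
  have hSu : S = Finset.univ := by
    rw [← Finset.card_eq_iff_eq_univ]; omega
  have e0 : G ≃g H := by
    refine ⟨(Equiv.subtypeUnivEquiv (p := (· ∈ S)) (fun x => by rw [hSu]; exact Finset.mem_univ x)).symm, ?_⟩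
    intro a b
    rw [← hHadj]
    rfl
  rw [hkn] at hiso
  rcases hiso with he | he
  · exact Or.inl ⟨e0.trans he.some⟩
  · exact Or.inr ⟨e0.trans he.some⟩

end ICE

/-- For odd `n ≥ 4` not divisible by `3`, any finite simple graph with the same
independence polynomial as `C_n` is isomorphic to `C_n` or to `D_n`. -/
theorem indep_equiv_class_Cn_not_mult_three {n : ℕ} (hn : 4 ≤ n) (hodd : Odd n)
    (h3 : ¬ (3 ∣ n)) {V : Type} [Fintype V] (G : SimpleGraph V)
    (h : G.indepPoly = (cycleGraph n).indepPoly) :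
    Nonempty (G ≃g cycleGraph n) ∨ Nonempty (G ≃g Dgraph n) := by
  exact ICE.main hn hodd h3 G h
end

section
/- Let n ≥ 5 be odd and let G be a finite simple graph with I(G,x) = I(C_n,x). Then n(3n−11)/2 = e_2(G) + n_G(P_3 ∪ K_1) − n_G(C_3 ∪ K_1) − n_G(P_4) − n_G(K_{1,3}) + n_G(D_4) + n_G(C_4), where e_2(G) is the number of matchings of size 2 in G and n_G(H) is the number of subgraphs of G (not necessarily induced) isomorphic to H. -/
open Polynomial SimpleGraph

/-- `subgraphCount G H` : the number of subgraphs of `G` (not necessarily induced)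
which are isomorphic to `H`. -/
noncomputable def subgraphCount {V W : Type*} [Fintype V] [Fintype W]
    (G : SimpleGraph V) (H : SimpleGraph W) : ℕ :=
  Nat.card {s : G.Subgraph // Nonempty (s.coe ≃g H)}

open scoped Classical in
theorem coeff_emb {V : Type*} [Fintype V] (G : SimpleGraph V) (k : ℕ) :
    (k.factorial : ℚ) * (G.indepPoly).coeff k =
      ∑ f : Fin k ↪ V, if ∀ i j, ¬ G.Adj (f i) (f j) then (1 : ℚ) else 0 := by
  have h1 : ∀ f : Fin k ↪ V, (∀ i j, ¬ G.Adj (f i) (f j)) ↔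
      G.IsIndepFinset (Finset.univ.map f) := by
    intro f
    simp [SimpleGraph.IsIndepFinset]
  simp_rw [h1]
  rw [← Finset.sum_fiberwise (s := Finset.univ) (g := fun f : Fin k ↪ V => Finset.univ.map f)]
  unfold SimpleGraph.indepPoly
  rw [Polynomial.finsetSum_coeff, Finset.mul_sum]
  refine Finset.sum_congr rfl fun s _ => ?_
  have h2 : ∀ f ∈ Finset.univ.filter (fun f : Fin k ↪ V => Finset.univ.map f = s),
      (if G.IsIndepFinset (Finset.univ.map f) then (1 : ℚ) else 0) =
        if G.IsIndepFinset s then 1 else 0 := by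
    intro f hf
    simp only [Finset.mem_filter] at hf
    rw [hf.2]
  rw [Finset.sum_congr rfl h2, Finset.sum_const, nsmul_eq_mul]
  by_cases hs : G.IsIndepFinset s
  · simp only [hs, if_true, Polynomial.coeff_X_pow, mul_one]
    by_cases hk : k = s.card
    · rw [if_pos hk, mul_one]
      norm_cast
      let e : {f : Fin k ↪ V // Finset.univ.map f = s} ≃ (Fin k ↪ s) :=
        { toFun := fun f => ⟨fun i => ⟨f.1 i, (Finset.ext_iff.1 f.2 _).1 (by simp)⟩, fun i j hij => by
            simpa using hij⟩
          invFun := fun g => ⟨g.trans (Function.Embedding.subtype _), by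
            apply Finset.eq_of_subset_of_card_le
            · intro x; simp only [Finset.mem_map]; rintro ⟨i, _, rfl⟩; exact (g i).2
            · simp [hk]⟩
          left_inv := fun f => by ext; rfl
          right_inv := fun g => by ext; rfl }
      rw [← Fintype.card_subtype, Fintype.card_congr e, Fintype.card_embedding_eq]
      simp [← hk, Nat.descFactorial_self]
    · rw [if_neg hk, mul_zero, eq_comm]
      norm_cast
      rw [Finset.card_eq_zero, Finset.filter_eq_empty_iff]
      rintro f - hf
      apply hk
      rw [← hf]; simp
  · simp [hs]

theorem iso_count {V W : Type*} [Fintype V] [Fintype W] (G : SimpleGraph V) (H : SimpleGraph W) :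
    subgraphCount G H * Nat.card (H ≃g H) = Nat.card (Copy H G) := by
  unfold subgraphCount
  rw [← Nat.card_prod]
  apply Nat.card_congr
  let e1 : (s : {s : G.Subgraph // Nonempty (s.coe ≃g H)}) → (H ≃g H) ≃ (H ≃g s.1.coe) := fun s =>
    { toFun := fun a => a.trans s.2.some.symm
      invFun := fun a => a.trans s.2.some
      left_inv := fun a => by ext x; simp
      right_inv := fun a => by ext x; simp }
  let e2 : (Σ s : {s : G.Subgraph // Nonempty (s.coe ≃g H)}, (H ≃g s.1.coe)) → Copy H G := fun p =>
    p.1.1.coeCopy.comp p.2.toCopy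
  refine (Equiv.sigmaEquivProd _ _).symm.trans ((Equiv.sigmaCongrRight e1).trans
    (Equiv.ofBijective e2 ⟨?_, ?_⟩))
  · rintro ⟨⟨s, hs⟩, a⟩ ⟨⟨t, ht⟩, b⟩ hab
    have key : ∀ x, ((a x : s.verts) : V) = ((b x : t.verts) : V) := fun x => DFunLike.congr_fun hab x
    have hst : s = t := by
      have gen : ∀ (u : G.Subgraph) (c : H ≃g u.coe), u = (u.coeCopy.comp c.toCopy).toSubgraph := by
        intro u c
        ext x y
        · constructor
          · intro hx
            exact ⟨c.symm ⟨x, hx⟩, trivial, by simp [Subgraph.coeCopy]⟩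
          · rintro ⟨z, -, rfl⟩
            exact (c z).2
        · constructor
          · intro hxy
            have hx := u.edge_vert hxy
            have hy := u.edge_vert hxy.symm
            refine ⟨c.symm ⟨x, hx⟩, c.symm ⟨y, hy⟩, ?_, by simp [Subgraph.coeCopy], by simp [Subgraph.coeCopy]⟩
            exact c.symm.map_rel_iff.2 hxy
          · rintro ⟨z, w, hzw, rfl, rfl⟩
            exact c.map_rel_iff.2 hzw
      rw [gen s a, gen t b]
      exact congrArg _ hab
    subst hst
    congr 1
    ext x
    exact key x
  · intro f
    exact ⟨⟨⟨f.toSubgraph, ⟨f.isoToSubgraph.symm⟩⟩, f.isoToSubgraph⟩, by ext x; rfl⟩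

theorem copy_sum {V W : Type*} [Fintype V] [Fintype W] (G : SimpleGraph V) [DecidableRel G.Adj]
    (H : SimpleGraph W) [DecidableRel H.Adj] (e : Fin 4 ≃ W) :
    subgraphCount G H * (Finset.univ.filter (fun σ : Equiv.Perm (Fin 4) =>
      ∀ i j, H.Adj (e (σ i)) (e (σ j)) ↔ H.Adj (e i) (e j))).card =
    ∑ f : Fin 4 ↪ V, if ∀ i j, H.Adj (e i) (e j) → G.Adj (f i) (f j) then 1 else 0 := by
  have h1 : (Finset.univ.filter (fun σ : Equiv.Perm (Fin 4) =>
      ∀ i j, H.Adj (e (σ i)) (e (σ j)) ↔ H.Adj (e i) (e j))).card = Nat.card (H ≃g H) := by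
    rw [← Fintype.card_subtype, ← Nat.card_eq_fintype_card]
    apply Nat.card_congr
    exact
      { toFun := fun σ => ⟨(e.symm.trans σ.1).trans e, by
          intro a b; have := σ.2 (e.symm a) (e.symm b); simpa using this⟩
        invFun := fun g => ⟨(e.trans g.toEquiv).trans e.symm, by
          intro i j; simpa using g.map_rel_iff (a := e i) (b := e j)⟩
        left_inv := fun σ => by ext; simp
        right_inv := fun g => by ext; simp }
  rw [h1, iso_count, ← Finset.card_filter, ← Fintype.card_subtype, ← Nat.card_eq_fintype_card]
  apply Nat.card_congr
  exact
      { toFun := fun c => ⟨e.toEmbedding.trans c.toEmbedding, by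
          intro i j hij; exact c.toHom.map_rel hij⟩
        invFun := fun f => ⟨⟨e.symm.toEmbedding.trans f.1, by
          intro a b hab; exact f.2 (e.symm a) (e.symm b) (by simpa using hab)⟩,
            (e.symm.toEmbedding.trans f.1).injective⟩
        left_inv := fun c => by ext a; exact congrArg c (e.apply_symm_apply a)
        right_inv := fun f => by ext a; exact congrArg f.1 (e.symm_apply_apply a) }

def ev (E : List (Fin 4 × Fin 4)) (a : Fin 4 → Fin 4 → Bool) : ℤ :=
  if E.all (fun p => a p.1 p.2) then 1 else 0

def ei (a : Fin 4 → Fin 4 → Bool) : ℤ :=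
  if a 0 1 || a 0 2 || a 0 3 || a 1 2 || a 1 3 || a 2 3 then 0 else 1

def total (a : Fin 4 → Fin 4 → Bool) : ℤ :=
  ei a - 1 + 6 * ev [(0,1)] a - 3 * ev [(0,1),(2,3)] a - 12 * ev [(0,1),(1,2)] a
    + 4 * ev [(0,1),(1,2),(0,2)] a + 12 * ev [(0,1),(1,2),(2,3)] a
    + 4 * ev [(0,1),(0,2),(0,3)] a - 12 * ev [(0,1),(1,2),(0,2),(2,3)] a
    - 3 * ev [(0,1),(1,2),(2,3),(3,0)] a
    + 6 * ev [(0,1),(1,2),(0,2),(1,3),(2,3)] a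
    - ev [(0,1),(1,2),(0,2),(1,3),(2,3),(0,3)] a

def mkA (a b c d e f : Bool) (i j : Fin 4) : Bool :=
  match i, j with
  | 0, 1 => a | 1, 0 => a
  | 0, 2 => b | 2, 0 => b
  | 0, 3 => c | 3, 0 => c
  | 1, 2 => d | 2, 1 => d
  | 1, 3 => e | 3, 1 => e
  | 2, 3 => f | 3, 2 => f
  | _, _ => false

set_option maxRecDepth 100000 in
set_option maxHeartbeats 4000000 in
theorem total_mk : ∀ a b c d e f : Bool,
    ∑ σ : Equiv.Perm (Fin 4), total (fun i j => mkA a b c d e f (σ i) (σ j)) = 0 := by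
  decide +kernel

theorem total_sum {V : Type*} [Fintype V] (G : SimpleGraph V) [DecidableRel G.Adj] :
    ∑ f : Fin 4 ↪ V, total (fun i j => decide (G.Adj (f i) (f j))) = 0 := by
  have h1 : ∀ σ : Equiv.Perm (Fin 4),
      ∑ f : Fin 4 ↪ V, total (fun i j => decide (G.Adj (f (σ i)) (f (σ j)))) =
      ∑ f : Fin 4 ↪ V, total (fun i j => decide (G.Adj (f i) (f j))) := by
    intro σ
    exact Fintype.sum_equiv (Equiv.embeddingCongr σ.symm (Equiv.refl V)) _ _ (fun f => by
      simp [Equiv.embeddingCongr])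
  have h2 : ∑ σ : Equiv.Perm (Fin 4),
      ∑ f : Fin 4 ↪ V, total (fun i j => decide (G.Adj (f (σ i)) (f (σ j)))) = 0 := by
    rw [Finset.sum_comm]
    refine Finset.sum_eq_zero fun f _ => ?_
    have h3 := total_mk (decide (G.Adj (f 0) (f 1))) (decide (G.Adj (f 0) (f 2)))
      (decide (G.Adj (f 0) (f 3))) (decide (G.Adj (f 1) (f 2))) (decide (G.Adj (f 1) (f 3)))
      (decide (G.Adj (f 2) (f 3)))
    rw [← h3]
    refine Finset.sum_congr rfl fun σ _ => ?_
    congr 1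
    funext i j
    have h4 : ∀ i j : Fin 4, decide (G.Adj (f i) (f j)) = mkA (decide (G.Adj (f 0) (f 1)))
      (decide (G.Adj (f 0) (f 2)))
      (decide (G.Adj (f 0) (f 3))) (decide (G.Adj (f 1) (f 2))) (decide (G.Adj (f 1) (f 3)))
      (decide (G.Adj (f 2) (f 3))) i j := by
      intro i j
      fin_cases i <;> fin_cases j <;> simp [mkA] <;> exact G.adj_comm _ _
    exact h4 _ _
  rw [Finset.sum_congr rfl (fun σ _ => h1 σ), Finset.sum_const] at h2
  simpa [Fintype.card_perm, Nat.factorial] using h2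

theorem copy_ev {V W : Type*} [Fintype V] [Fintype W] (G : SimpleGraph V) [DecidableRel G.Adj]
    (H : SimpleGraph W) [DecidableRel H.Adj] (e : Fin 4 ≃ W) (E : List (Fin 4 × Fin 4)) (k : ℕ)
    (hE : ∀ i j, H.Adj (e i) (e j) ↔ (i, j) ∈ E ∨ (j, i) ∈ E)
    (hk : (Finset.univ.filter (fun σ : Equiv.Perm (Fin 4) =>
      ∀ i j, H.Adj (e (σ i)) (e (σ j)) ↔ H.Adj (e i) (e j))).card = k) :
    ∑ f : Fin 4 ↪ V, ev E (fun i j => decide (G.Adj (f i) (f j))) = k * subgraphCount G H := by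
  have h := copy_sum G H e
  rw [hk] at h
  rw [mul_comm]
  have h' : ((subgraphCount G H * k : ℕ) : ℤ) = _ := congrArg Nat.cast h
  push_cast at h'
  rw [h']
  refine Finset.sum_congr rfl fun f _ => ?_
  unfold ev
  have : (E.all (fun p => decide (G.Adj (f p.1) (f p.2))) = true) ↔
      ∀ i j, H.Adj (e i) (e j) → G.Adj (f i) (f j) := by
    simp only [List.all_eq_true, decide_eq_true_eq, Prod.forall]
    constructor
    · intro h i j hij
      rcases (hE i j).1 hij with h1 | h1
      · exact h i j h1
      · exact (h j i h1).symm
    · intro h i j hij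
      exact h i j ((hE i j).2 (Or.inl hij))
  simp only [this]

instance pathDec (n : ℕ) : DecidableRel (pathGraph n).Adj := fun i j =>
  decidable_of_iff _ pathGraph_adj.symm
instance dDec (n : ℕ) : DecidableRel (Dgraph n).Adj := by
  unfold Dgraph; intro i j; exact decidable_of_iff _ (SimpleGraph.fromRel_adj _ _ _).symm
instance cycDec (n : ℕ) : DecidableRel (cycleGraph n).Adj := fun i j =>
  decidable_of_iff _ cycleGraph_adj'.symm
instance sumDec {A B : Type*} (G : SimpleGraph A) (H : SimpleGraph B) [DecidableRel G.Adj]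
    [DecidableRel H.Adj] : DecidableRel (G ⊕g H).Adj := fun i j => by
  rcases i with i | i <;> rcases j with j | j
  · exact decidable_of_iff (G.Adj i j) (by simp)
  · exact isFalse (by simp)
  · exact isFalse (by simp)
  · exact decidable_of_iff (H.Adj i j) (by simp)

instance kDec : DecidableRel (completeBipartiteGraph (Fin 1) (Fin 3)).Adj := fun _ _ =>
  inferInstanceAs (Decidable (_ ∨ _))

section counts
variable {V : Type*} [Fintype V] (G : SimpleGraph V) [DecidableRel G.Adj]

theorem c_2P2 : ∑ f : Fin 4 ↪ V, ev [(0,1),(2,3)] (fun i j => decide (G.Adj (f i) (f j))) =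
    8 * subgraphCount G (pathGraph 2 ⊕g pathGraph 2) :=
  copy_ev G (pathGraph 2 ⊕g pathGraph 2) (finSumFinEquiv (m := 2) (n := 2)).symm _ 8
    (by decide +kernel) (by decide +kernel)

theorem c_P3K1 : ∑ f : Fin 4 ↪ V, ev [(0,1),(1,2)] (fun i j => decide (G.Adj (f i) (f j))) =
    2 * subgraphCount G (pathGraph 3 ⊕g pathGraph 1) :=
  copy_ev G (pathGraph 3 ⊕g pathGraph 1) (finSumFinEquiv (m := 3) (n := 1)).symm _ 2
    (by decide +kernel) (by decide +kernel)

theorem c_C3K1 : ∑ f : Fin 4 ↪ V, ev [(0,1),(1,2),(0,2)] (fun i j => decide (G.Adj (f i) (f j))) =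
    6 * subgraphCount G (cycleGraph 3 ⊕g pathGraph 1) :=
  copy_ev G (cycleGraph 3 ⊕g pathGraph 1) (finSumFinEquiv (m := 3) (n := 1)).symm _ 6
    (by decide +kernel) (by decide +kernel)

theorem c_P4 : ∑ f : Fin 4 ↪ V, ev [(0,1),(1,2),(2,3)] (fun i j => decide (G.Adj (f i) (f j))) =
    2 * subgraphCount G (pathGraph 4) :=
  copy_ev G (pathGraph 4) (Equiv.refl _) _ 2
    (by decide +kernel) (by decide +kernel)

theorem c_K13 : ∑ f : Fin 4 ↪ V, ev [(0,1),(0,2),(0,3)] (fun i j => decide (G.Adj (f i) (f j))) =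
    6 * subgraphCount G (completeBipartiteGraph (Fin 1) (Fin 3)) := by
  exact copy_ev G (completeBipartiteGraph (Fin 1) (Fin 3)) (finSumFinEquiv (m := 1) (n := 3)).symm _ 6
    (by decide +kernel)
    (by decide +kernel)

theorem c_D4 : ∑ f : Fin 4 ↪ V, ev [(0,1),(1,2),(0,2),(2,3)] (fun i j => decide (G.Adj (f i) (f j))) =
    2 * subgraphCount G (Dgraph 4) :=
  copy_ev G (Dgraph 4) (Equiv.refl _) _ 2
    (by decide +kernel) (by decide +kernel)

theorem c_C4 : ∑ f : Fin 4 ↪ V, ev [(0,1),(1,2),(2,3),(3,0)] (fun i j => decide (G.Adj (f i) (f j))) =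
    8 * subgraphCount G (cycleGraph 4) :=
  copy_ev G (cycleGraph 4) (Equiv.refl _) _ 8
    (by decide +kernel) (by decide +kernel)

open scoped Classical in
theorem c_edge : ∑ f : Fin 4 ↪ V, ev [(0,1)] (fun i j => decide (G.Adj (f i) (f j))) =
    (Fintype.card V - 2).descFactorial 2 *
      ∑ f : Fin 2 ↪ V, if G.Adj (f 0) (f 1) then 1 else 0 := by
  let e : (Fin 4 ↪ V) ≃ (Σ f : Fin 2 ↪ V, Fin 2 ↪ ↥(Set.range f)ᶜ) :=
    (Equiv.embeddingCongr (finSumFinEquiv (m := 2) (n := 2)).symm (Equiv.refl V)).trans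
      Equiv.sumEmbeddingEquivSigmaEmbeddingRestricted
  have h0 : ∀ f : Fin 4 ↪ V, (e f).1 0 = f 0 := fun f => rfl
  have h1 : ∀ f : Fin 4 ↪ V, (e f).1 1 = f 1 := fun f => rfl
  rw [Fintype.sum_equiv e _ (fun p => if G.Adj (p.1 0) (p.1 1) then (1 : ℤ) else 0)
    (fun f => by rw [h0, h1]; simp [ev])]
  rw [Fintype.sum_sigma, Finset.mul_sum]
  refine Finset.sum_congr rfl fun f _ => ?_
  change ∑ y : (Fin 2 ↪ ↥(Set.range f)ᶜ), (if G.Adj (f 0) (f 1) then (1:ℤ) else 0) = _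
  rw [Finset.sum_const, nsmul_eq_mul, Finset.card_univ, Fintype.card_embedding_eq]
  congr 2
  rw [Fintype.card_fin, ← Set.toFinset_card, Set.toFinset_compl, Finset.card_compl]
  simp [Set.toFinset_range, Finset.card_image_of_injective _ f.injective]

theorem two_coeff : 2 * (G.indepPoly).coeff 2 = (Fintype.card V : ℚ) * (Fintype.card V - 1) -
    ((∑ f : Fin 2 ↪ V, if G.Adj (f 0) (f 1) then 1 else 0 : ℤ) : ℚ) := by
  have h := coeff_emb G 2
  have h2 : ((Nat.factorial 2 : ℕ) : ℚ) * (G.indepPoly).coeff 2 =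
      ∑ f : Fin 2 ↪ V, (1 - if G.Adj (f 0) (f 1) then (1 : ℚ) else 0) := by
    rw [h]
    refine Finset.sum_congr rfl fun f _ => ?_
    by_cases hf : G.Adj (f 0) (f 1) <;> simp [Fin.forall_fin_two, hf, G.adj_comm (f 1)]
  have h3 : (Fintype.card (Fin 2 ↪ V) : ℚ) = (Fintype.card V : ℚ) * (Fintype.card V - 1) := by
    rw [Fintype.card_embedding_eq, Fintype.card_fin, Nat.cast_descFactorial_two]
  rw [Finset.sum_sub_distrib, Finset.sum_const, Finset.card_univ, nsmul_eq_mul, mul_one, h3] at h2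
  push_cast
  simpa using h2

theorem one_coeff : (G.indepPoly).coeff 1 = (Fintype.card V : ℚ) := by
  have h := coeff_emb G 1
  have h2 : ∀ f : Fin 1 ↪ V, (∀ i j, ¬ G.Adj (f i) (f j)) := by
    intro f i j; rw [Subsingleton.elim i j]; exact G.irrefl
  simp [h2] at h
  simpa [Fintype.card_embedding_eq] using h

theorem zero_coeff : (G.indepPoly).coeff 0 = 1 := by
  have h := coeff_emb G 0
  simp at h
  simpa [Fintype.card_embedding_eq] using h

theorem four_coeff : 24 * (G.indepPoly).coeff 4 =
    ((∑ f : Fin 4 ↪ V, ei (fun i j => decide (G.Adj (f i) (f j))) : ℤ) : ℚ) := by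
  have h := coeff_emb G 4
  rw [show (Nat.factorial 4 : ℚ) = 24 by norm_num [Nat.factorial]] at h
  rw [h]
  push_cast
  refine Finset.sum_congr rfl fun f _ => ?_
  unfold ei
  by_cases hh : ∀ i j, ¬ G.Adj (f i) (f j)
  · simp [hh]
  · rw [if_neg hh, if_pos]
    · simp
    · push Not at hh
      obtain ⟨i, j, hij⟩ := hh
      fin_cases i <;> fin_cases j <;> simp_all [G.adj_comm] <;> simp [hij.symm]

theorem main_count (hd : ∀ a b c d : V, G.Adj a b → G.Adj b c → G.Adj a c → G.Adj b d →
      G.Adj c d → a ≠ d → False) (N : ℕ) (hN : Fintype.card V = N) (hN2 : 5 ≤ N)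
      (h2 : 2 * (G.indepPoly).coeff 2 = N * (N - 3)) :
    (G.indepPoly).coeff 4 = (N : ℚ) * (N - 1) * (N - 2) * (N - 3) / 24
      - N * (N - 2) * (N - 3) / 2 + 
      ((subgraphCount G (pathGraph 2 ⊕g pathGraph 2) : ℚ)
      + (subgraphCount G (pathGraph 3 ⊕g pathGraph 1) : ℚ)
      - (subgraphCount G (cycleGraph 3 ⊕g pathGraph 1) : ℚ)
      - (subgraphCount G (pathGraph 4) : ℚ)
      - (subgraphCount G (completeBipartiteGraph (Fin 1) (Fin 3)) : ℚ)
      + (subgraphCount G (Dgraph 4) : ℚ)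
      + (subgraphCount G (cycleGraph 4) : ℚ)) := by
  have ht := total_sum G
  have z1 : ∑ f : Fin 4 ↪ V, ev [(0,1),(1,2),(0,2),(1,3),(2,3)]
      (fun i j => decide (G.Adj (f i) (f j))) = 0 := by
    refine Finset.sum_eq_zero fun f _ => ?_
    unfold ev
    rw [if_neg]
    simp only [List.all_cons, List.all_nil, Bool.and_eq_true, decide_eq_true_eq]
    rintro ⟨h1, h2, h3, h4, h5, -⟩
    exact hd _ _ _ _ h1 h2 h3 h4 h5 (fun h => by simpa using f.injective h)
  have z2 : ∑ f : Fin 4 ↪ V, ev [(0,1),(1,2),(0,2),(1,3),(2,3),(0,3)]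
      (fun i j => decide (G.Adj (f i) (f j))) = 0 := by
    refine Finset.sum_eq_zero fun f _ => ?_
    unfold ev
    rw [if_neg]
    simp only [List.all_cons, List.all_nil, Bool.and_eq_true, decide_eq_true_eq]
    rintro ⟨h1, h2, h3, h4, h5, -⟩
    exact hd _ _ _ _ h1 h2 h3 h4 h5 (fun h => by simpa using f.injective h)
  have h4 := four_coeff G
  have h2' := two_coeff G
  have he := c_edge G
  unfold total at ht
  simp only [Finset.sum_add_distrib, Finset.sum_sub_distrib, ← Finset.mul_sum, z1, z2, c_2P2,
    c_P3K1, c_C3K1, c_P4, c_K13, c_D4, c_C4, he, Finset.sum_const, Finset.card_univ,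
    Fintype.card_embedding_eq, Fintype.card_fin, hN] at ht
  rw [nsmul_eq_mul, mul_one] at ht
  have ht' := congrArg (fun z : ℤ => (z : ℚ)) ht
  have hs : (((∑ f : Fin 2 ↪ V, if G.Adj (f 0) (f 1) then 1 else 0 : ℤ)) : ℚ) = 2 * N := by
    rw [hN] at h2'; linarith
  have d2 : ((N - 2).descFactorial 2 : ℚ) = (N - 2) * (N - 3) := by
    rw [Nat.cast_descFactorial_two, Nat.cast_sub (by omega)]; push_cast; ring
  have d4 : (N.descFactorial 4 : ℚ) = N * (N - 1) * (N - 2) * (N - 3) := by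
    obtain ⟨m, rfl⟩ : ∃ m, N = m + 5 := ⟨N - 5, by omega⟩
    simp only [Nat.descFactorial_succ, Nat.descFactorial_zero]
    rw [show m + 5 - 3 = m + 2 by omega, show m + 5 - 2 = m + 3 by omega,
      show m + 5 - 1 = m + 4 by omega]
    push_cast; ring
  simp only [Int.cast_add, Int.cast_sub, Int.cast_mul, hs] at ht'
  rw [← h4] at ht'
  push_cast at ht'
  rw [d2, d4] at ht'
  linarith
end counts

noncomputable def tw (a b : Bool) : ℚ[X] := if a && b then 0 else (if b then X else 1)

noncomputable def tmat : Matrix Bool Bool ℚ[X] := Matrix.of tw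

theorem tr_path (m : ℕ) (a : Bool) (F : Bool → ℚ[X]) :
    ∑ g : Fin m → Bool, (∏ i : Fin m, tw ((Fin.cons a g : Fin (m+1) → Bool) i.castSucc)
      ((Fin.cons a g : Fin (m+1) → Bool) i.succ)) * F ((Fin.cons a g : Fin (m+1) → Bool) (Fin.last m)) =
    ∑ b, (tmat ^ m) a b * F b := by
  induction m generalizing a with
  | zero => cases a <;> simp [Matrix.one_apply]
  | succ m ih =>
    rw [← (Fin.consEquiv (fun _ : Fin (m+1) => Bool)).sum_comp, Fintype.sum_prod_type]
    simp only [pow_succ', Matrix.mul_apply, Finset.sum_mul]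
    rw [Finset.sum_comm (s := (Finset.univ : Finset Bool)) (t := (Finset.univ : Finset Bool))]
    refine Finset.sum_congr rfl fun c _ => ?_
    have := ih c
    simp only [mul_assoc, ← Finset.mul_sum]
    rw [← this, Finset.mul_sum]
    refine Finset.sum_congr rfl fun g _ => ?_
    rw [Fin.prod_univ_succ]
    simp only [Fin.consEquiv_apply, Fin.castSucc_zero, Fin.cons_zero, Fin.cons_succ, 
      Fin.castSucc_succ, ← Fin.succ_last, tmat, Matrix.of_apply, mul_assoc]

theorem tmat_sq : tmat ^ 2 = tmat + (X : ℚ[X]) • (1 : Matrix Bool Bool ℚ[X]) := by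
  ext a b : 1
  rw [pow_two, Matrix.mul_apply]
  cases a <;> cases b <;> simp [tmat, tw, add_comm]

theorem cyc_poly (m : ℕ) : (cycleGraph (m+2)).indepPoly = (tmat ^ (m+2)).trace := by
  classical
  have h1 : (tmat ^ (m+2)).trace = ∑ f : Fin (m+2) → Bool, ∏ i, tw (f i) (f (i+1)) := by
    rw [← (Fin.consEquiv (fun _ : Fin (m+2) => Bool)).sum_comp, Fintype.sum_prod_type, Matrix.trace]
    refine Finset.sum_congr rfl fun a _ => ?_
    rw [Matrix.diag_apply, pow_succ, Matrix.mul_apply]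
    have := tr_path (m+1) a (fun b => tmat b a)
    rw [← this]
    refine Finset.sum_congr rfl fun g _ => ?_
    symm
    rw [Fin.prod_univ_castSucc]
    simp [Fin.consEquiv_apply, tmat]
  rw [h1]
  unfold SimpleGraph.indepPoly
  let e : Finset (Fin (m+2)) ≃ (Fin (m+2) → Bool) :=
    { toFun := fun s i => decide (i ∈ s)
      invFun := fun f => Finset.univ.filter (fun i => f i = true)
      left_inv := fun s => by ext; simp
      right_inv := fun f => by ext; simp }
  refine Fintype.sum_equiv e _ _ fun s => ?_
  by_cases hs : (cycleGraph (m+2)).IsIndepFinset s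
  · rw [if_pos hs]
    have h2 : ∀ i, tw (e s i) (e s (i+1)) = if i + 1 ∈ s then X else 1 := by
      intro i
      have : ¬ (i ∈ s ∧ i + 1 ∈ s) := by
        rintro ⟨h1, h2⟩
        exact hs i h1 _ h2 (by rw [cycleGraph_adj]; right; simp)
      simp [tw, e, this]
    rw [Finset.prod_congr rfl (fun i _ => h2 i)]
    refine Eq.trans ?_ (Equiv.prod_comp (Equiv.addRight (1 : Fin (m+2)))
      (fun i => if i ∈ s then (X : ℚ[X]) else 1)).symm
    simp [Finset.prod_ite_mem]
  · rw [if_neg hs]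
    unfold SimpleGraph.IsIndepFinset at hs
    push Not at hs
    obtain ⟨v, hv, w, hw, hvw⟩ := hs
    rw [cycleGraph_adj] at hvw
    obtain ⟨i, hi, hi1⟩ : ∃ i, i ∈ s ∧ i + 1 ∈ s := by
      rcases hvw with h | h
      · exact ⟨w, hw, by rw [← h]; simpa using hv⟩
      · exact ⟨v, hv, by rw [← h]; simpa using hw⟩
    symm
    apply Finset.prod_eq_zero (Finset.mem_univ i)
    simp [tw, e, hi, hi1]

noncomputable def Lp : ℕ → ℚ[X]
  | 0 => 2
  | 1 => 1
  | (n+2) => Lp (n+1) + X * Lp n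

theorem tr_Lp (n : ℕ) : (tmat ^ n).trace = Lp n := by
  induction n using Nat.twoStepInduction with
  | zero => simp [Lp]
  | one => simp [Lp, Matrix.trace, tmat, tw]
  | more n h1 h2 =>
    rw [pow_add, tmat_sq, mul_add, ← pow_succ, Matrix.trace_add, h2, Matrix.mul_smul, mul_one,
      Matrix.trace_smul, h1, Lp, smul_eq_mul]

theorem cyc_Lp (n : ℕ) (hn : 2 ≤ n) : (cycleGraph n).indepPoly = Lp n := by
  obtain ⟨m, rfl⟩ : ∃ m, n = m + 2 := ⟨n - 2, by omega⟩
  rw [cyc_poly, tr_Lp]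

theorem Lp_coeff (m : ℕ) :
    (Lp (m+1)).coeff 0 = 1 ∧ (Lp (m+2)).coeff 1 = (m+2 : ℚ) ∧
    (Lp (m+3)).coeff 2 = (m+3 : ℚ) * m / 2 ∧
    (Lp (m+4)).coeff 3 = (m+4 : ℚ) * m * (m-1) / 6 ∧
    (Lp (m+5)).coeff 4 = (m+5 : ℚ) * m * (m-1) * (m-2) / 24 := by
  have hr : ∀ n k, (Lp (n+2)).coeff (k+1) = (Lp (n+1)).coeff (k+1) + (Lp n).coeff k := by
    intro n k; rw [Lp, Polynomial.coeff_add, Polynomial.coeff_X_mul]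
  have hr0 : ∀ n, (Lp (n+2)).coeff 0 = (Lp (n+1)).coeff 0 := by
    intro n; rw [Lp, Polynomial.coeff_add, Polynomial.coeff_X_mul_zero, add_zero]
  have i00 : (Lp 0).coeff 0 = 2 := by simp [Lp]
  have i0 : ∀ k, (Lp 0).coeff (k+1) = 0 := fun k => by
    rw [Lp]; exact Polynomial.coeff_ofNat_succ 2 k
  have i1 : ∀ k, (Lp 1).coeff (k+1) = 0 := fun k => by rw [Lp]; simp [Polynomial.coeff_one]
  have i10 : (Lp 1).coeff 0 = 1 := by rw [Lp]; simp
  induction m with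
  | zero =>
    refine ⟨i10, ?_, ?_, ?_, ?_⟩ <;>
    norm_num [hr, hr0, i00, i0, i1, i10]
  | succ m ih =>
    obtain ⟨a0, a1, a2, a3, a4⟩ := ih
    refine ⟨?_, ?_, ?_, ?_, ?_⟩
    · rw [hr0, a0]
    · rw [hr (m+1) 0, a1, a0]; push_cast; ring
    · rw [hr (m+2) 1, a2, a1]; push_cast; ring
    · rw [hr (m+3) 2, a3, a2]; push_cast; ring
    · rw [hr (m+4) 3, a4, a3]; push_cast; ring

theorem Lp_binet {L : Type*} [Field L] [Algebra ℚ L] (u : L) (hu : u ≠ 1) (n : ℕ) :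
    (1 - u) ^ n * aeval (u / (1 - u) ^ 2) (Lp n) = 1 + (-u) ^ n := by
  have h : (1 - u) ≠ 0 := sub_ne_zero.2 (Ne.symm hu)
  induction n using Nat.twoStepInduction with
  | zero => rw [Lp, map_ofNat]; norm_num
  | one => simp [Lp]; ring
  | more n h1 h2 =>
    rw [Lp, map_add, map_mul, aeval_X, mul_add]
    have e1 : (1 - u) ^ (n+2) * (aeval (u / (1 - u) ^ 2)) (Lp (n + 1)) =
      (1 - u) * (1 + (-u) ^ (n+1)) := by rw [← h2]; ring
    have e2 : (1 - u) ^ (n+2) * (u / (1 - u) ^ 2 * (aeval (u / (1 - u) ^ 2)) (Lp n)) =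
      u * (1 + (-u) ^ n) := by rw [← h1, pow_add]; field_simp
    rw [e1, e2]; ring

theorem ms_coeff {L : Type*} [Field L] (M : Multiset L) :
    ((M.map (fun c => 1 + C c * X)).prod).coeff 0 = 1 ∧
    ((M.map (fun c => 1 + C c * X)).prod).coeff 1 = M.sum ∧
    M.sum ^ 2 - 2 * ((M.map (fun c => 1 + C c * X)).prod).coeff 2 = (M.map (fun c => c ^ 2)).sum := by
  induction M using Multiset.induction_on with
  | empty => simp [Polynomial.coeff_one]
  | cons c M ih =>
    obtain ⟨h0, h1, h2⟩ := ih
    simp only [Multiset.map_cons, Multiset.prod_cons, Multiset.sum_cons, add_mul, one_mul,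
      Polynomial.coeff_add, mul_assoc, Polynomial.coeff_C_mul, Polynomial.coeff_X_mul,
      Polynomial.coeff_X_mul_zero]
    rw [h0, h1, ← h2]
    refine ⟨by ring, by ring, by ring⟩

theorem factor_coeff_aux (L : Type) [Field L] [CharZero L] [Algebra ℚ L] [IsAlgClosed L]
    [Normal ℚ L] (n : ℕ) (hodd : Odd n) (g q : ℚ[X]) (hg : g * q = Lp n)
    (h0 : g.coeff 0 = 1) : g.coeff 1 ^ 2 - 2 * g.coeff 2 = 3 * g.coeff 1 := by
  have hn0 : n ≠ 0 := by rintro rfl; simp at hodd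
  have : NeZero n := ⟨hn0⟩
  have : NeZero (n : L) := ⟨by exact_mod_cast hn0⟩
  obtain ⟨ζ, hζ⟩ : ∃ ζ : L, IsPrimitiveRoot ζ n := HasEnoughRootsOfUnity.exists_primitiveRoot L n
  have hint : IsIntegral ℤ ζ := hζ.isIntegral (Nat.pos_of_ne_zero hn0)
  have hmin : minpoly ℚ ζ = minpoly ℚ (ζ ^ 2) := by
    rw [minpoly.isIntegrallyClosed_eq_field_fractions' ℚ hint,
      minpoly.isIntegrallyClosed_eq_field_fractions' ℚ (hint.pow 2),
      hζ.minpoly_eq_pow_coprime (Nat.coprime_two_left.2 hodd)]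
  obtain ⟨σ, hσ⟩ := (isConjRoot_iff_exists_algEquiv (K := ℚ) (L := L) (x := ζ ^ 2) (y := ζ)).1 hmin.symm
  have hσu : ∀ u : L, u ^ n = 1 → σ u = u ^ 2 := by
    intro u hu
    obtain ⟨i, -, rfl⟩ := hζ.eq_pow_of_pow_eq_one hu
    rw [map_pow, hσ, ← pow_mul, ← pow_mul, mul_comm]
  have hroot : ∀ a : L, aeval a g = 0 → a ≠ 0 ∧ σ (-a⁻¹) = 4 * (-a⁻¹) - (-a⁻¹) ^ 2 := by
    intro a ha
    have ha0 : a ≠ 0 := by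
      rintro rfl
      have : aeval (0 : L) g = algebraMap ℚ L (g.coeff 0) := by
        rw [Polynomial.coeff_zero_eq_aeval_zero, ← Polynomial.aeval_algebraMap_apply, map_zero]
      rw [this, h0] at ha
      simp at ha
    refine ⟨ha0, ?_⟩
    have hL : aeval a (Lp n) = 0 := by rw [← hg, map_mul, ha, zero_mul]
    set c : L := -a⁻¹ with hc
    have hc0 : c ≠ 0 := by rw [hc]; exact neg_ne_zero.2 (inv_ne_zero ha0)
    have hac : a * c = -1 := by rw [hc]; field_simp
    obtain ⟨s, hs⟩ := IsAlgClosed.exists_eq_mul_self ((2 - c) ^ 2 - 4)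
    obtain ⟨u, hu⟩ : ∃ u : L, u ^ 2 - (2 - c) * u + 1 = 0 :=
      ⟨((2 - c) + s) / 2, by field_simp; linear_combination -hs⟩
    have hu0 : u ≠ 0 := by rintro rfl; simp at hu
    have hu1 : u ≠ 1 := by
      rintro rfl; apply hc0; linear_combination hu
    have h1u : (1 - u) ≠ 0 := sub_ne_zero.2 (Ne.symm hu1)
    have hau : a = u / (1 - u) ^ 2 := by
      rw [eq_div_iff (pow_ne_zero 2 h1u)]
      linear_combination a * hu - u * hac
    have hb := Lp_binet u hu1 n
    rw [← hau, hL, mul_zero, hodd.neg_pow] at hb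
    have hun : u ^ n = 1 := by linear_combination hb
    have hcu : c = 2 - u - u⁻¹ := by
      field_simp; linear_combination hu
    rw [hcu, map_sub, map_sub, map_inv₀, hσu u hun, map_ofNat]
    field_simp
    ring
  have hg0 : g ≠ 0 := by rintro rfl; simp at h0
  have hsplit : g.map (algebraMap ℚ L) = C ((g.map (algebraMap ℚ L)).leadingCoeff) *
      ((g.map (algebraMap ℚ L)).roots.map (fun a => X - C a)).prod :=
    (IsAlgClosed.splits (g.map (algebraMap ℚ L))).eq_prod_roots
  set R := (g.map (algebraMap ℚ L)).roots with hR
  have hRr : ∀ a ∈ R, aeval a g = 0 := by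
    intro a ha
    rw [hR, Polynomial.mem_roots'] at ha
    simpa [Polynomial.IsRoot, Polynomial.eval_map_algebraMap] using ha.2
  set M := R.map (fun a => -a⁻¹) with hM
  have hprod : (R.map (fun a => X - C a)).prod =
      C ((R.map (fun a => -a)).prod) * (M.map (fun c => 1 + C c * X)).prod := by
    rw [hM, Multiset.map_map, map_multiset_prod, Multiset.map_map, 
      ← Multiset.prod_map_mul]
    congr 1
    refine Multiset.map_congr rfl fun a ha => ?_
    have := (hroot a (hRr a ha)).1
    simp only [Function.comp]
    rw [mul_add, ← mul_assoc, ← C_mul]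
    rw [show -a * -a⁻¹ = 1 by field_simp]
    simp; ring
  obtain ⟨m0, m1, m2⟩ := ms_coeff M
  have hgM : g.map (algebraMap ℚ L) = (M.map (fun c => 1 + C c * X)).prod := by
    rw [hprod, ← mul_assoc, ← C_mul] at hsplit
    have := congrArg (fun p => p.coeff 0) hsplit
    simp only [Polynomial.coeff_map, h0, map_one, Polynomial.coeff_C_mul, m0, mul_one] at this
    rw [← this] at hsplit
    simpa using hsplit
  rw [← hgM, Polynomial.coeff_map] at m1 m2
  have hs : σ M.sum = 4 * M.sum - (M.map (fun c => c ^ 2)).sum := by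
    have h4 : 4 * M.sum = (M.map (fun c => 4 * c)).sum := by
      rw [Multiset.sum_map_mul_left, Multiset.map_id']
    rw [map_multiset_sum, h4, ← Multiset.sum_map_sub] 
    congr 1
    rw [hM, Multiset.map_map, Multiset.map_map]
    refine Multiset.map_congr rfl fun a ha => ?_
    exact (hroot a (hRr a ha)).2
  rw [← m2, ← m1, AlgEquiv.commutes] at hs
  apply (algebraMap ℚ L).injective
  simp only [map_sub, map_mul, map_pow, map_ofNat]
  linear_combination hs

theorem exists_closure (k : Type) [Field k] :
    ∃ (K : Type) (_ : Field K) (_ : Algebra k K), IsAlgClosure k K :=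
  ⟨AlgebraicClosure k, inferInstance, inferInstance, inferInstance⟩

theorem factor_coeff (n : ℕ) (hodd : Odd n) (g q : ℚ[X]) (hg : g * q = Lp n)
    (h0 : g.coeff 0 = 1) : g.coeff 1 ^ 2 - 2 * g.coeff 2 = 3 * g.coeff 1 := by
  obtain ⟨K, _, _, _⟩ := exists_closure ℚ
  have : CharZero K := charZero_of_injective_algebraMap (algebraMap ℚ K).injective
  have : IsAlgClosed K := IsAlgClosure.isAlgClosed ℚ
  have : Normal ℚ K := IsAlgClosure.normal ℚ K
  exact factor_coeff_aux K n hodd g q hg h0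

theorem indepPoly_mul {V : Type*} [Fintype V] (G : SimpleGraph V) (S : Set V) [Fintype S]
    [Fintype ↥Sᶜ] (hS : ∀ u v, G.Adj u v → (u ∈ S ↔ v ∈ S)) :
    G.indepPoly = (G.induce S).indepPoly * (G.induce Sᶜ).indepPoly := by
  classical
  unfold SimpleGraph.indepPoly
  rw [Finset.sum_mul_sum, ← Fintype.sum_prod_type']
  let e : Finset V ≃ Finset S × Finset ↥Sᶜ :=
    (Equiv.finsetCongr (Equiv.Set.sumCompl S).symm).trans Finset.sumEquiv.toEquiv
  symm
  refine Fintype.sum_equiv e.symm _ _ fun p => ?_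
  obtain ⟨s, t⟩ := p
  have he : e.symm (s, t) = s.map (Function.Embedding.subtype _) ∪ t.map (Function.Embedding.subtype _) := by
    ext x
    simp only [e, Equiv.symm_trans_apply]
    by_cases hx : x ∈ S
    · have := Equiv.Set.sumCompl_symm_apply_of_mem (s := S) hx
      simp [this, hx]
    · have := Equiv.Set.sumCompl_symm_apply_of_notMem (s := S) hx
      simp [this, hx]
  have hcard : (e.symm (s, t)).card = s.card + t.card := by
    rw [he, Finset.card_union_of_disjoint, Finset.card_map, Finset.card_map]
    rw [Finset.disjoint_left]
    simp only [Finset.mem_map, Function.Embedding.subtype_apply]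
    rintro x ⟨y, _, rfl⟩ ⟨z, _, hz⟩
    exact z.2 (hz ▸ y.2)
  have hind : G.IsIndepFinset (e.symm (s, t)) ↔
      (G.induce S).IsIndepFinset s ∧ (G.induce Sᶜ).IsIndepFinset t := by
    rw [he]
    unfold SimpleGraph.IsIndepFinset
    constructor
    · intro h
      constructor
      · intro v hv w hw
        exact h v.1 (by simp [hv]) w.1 (by simp [hw])
      · intro v hv w hw
        exact h v.1 (Finset.mem_union_right _ (Finset.mem_map_of_mem _ hv)) w.1
          (Finset.mem_union_right _ (Finset.mem_map_of_mem _ hw))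
    · rintro ⟨h1, h2⟩ v hv w hw hvw
      simp only [Finset.mem_union, Finset.mem_map, Function.Embedding.subtype_apply] at hv hw
      have := hS v w hvw
      rcases hv with ⟨v, hv, rfl⟩ | ⟨v, hv, rfl⟩ <;> rcases hw with ⟨w, hw, rfl⟩ | ⟨w, hw, rfl⟩
      · exact h1 v hv w hw hvw
      · exact w.2 (this.1 v.2)
      · exact v.2 (this.2 w.2)
      · exact h2 v hv w hw hvw
  dsimp only
  rw [hcard, pow_add]
  by_cases a : (G.induce S).IsIndepFinset s <;> by_cases b : (G.induce Sᶜ).IsIndepFinset t <;>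
    simp [hind, a, b]

theorem dart_sum {V : Type*} [Fintype V] (G : SimpleGraph V) [DecidableRel G.Adj] :
    (∑ f : Fin 2 ↪ V, if G.Adj (f 0) (f 1) then 1 else 0 : ℤ) = 2 * Nat.card G.edgeSet := by
  classical
  have h := G.dart_card_eq_twice_card_edges
  have h2 : Nat.card G.edgeSet = G.edgeFinset.card := by
    rw [Nat.card_eq_fintype_card, edgeFinset_card]
  rw [h2]
  have h3 : ((∑ f : Fin 2 ↪ V, if G.Adj (f 0) (f 1) then 1 else 0 : ℕ)) = Fintype.card G.Dart := by
    rw [← Finset.card_filter, ← Fintype.card_subtype]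
    apply Fintype.card_congr
    exact
      { toFun := fun f => ⟨(f.1 0, f.1 1), f.2⟩
        invFun := fun x => ⟨⟨![x.fst, x.snd], by
          intro i j hij
          have := x.adj.ne
          fin_cases i <;> fin_cases j <;> simp_all⟩, x.adj⟩
        left_inv := fun f => by
          ext i; fin_cases i <;> rfl
        right_inv := fun x => rfl }
  have h4 := congrArg (fun z : ℕ => (z : ℤ)) (h3.trans h)
  push_cast at h4
  exact h4

theorem conn_diamond {V : Type*} [Finite V] (K : SimpleGraph V) (hK : K.Connected) (a b c d : V)
    (hab : K.Adj a b) (hbc : K.Adj b c) (hac : K.Adj a c) (hbd : K.Adj b d) (hcd : K.Adj c d)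
    (had : a ≠ d) : Nat.card V + 1 ≤ Nat.card K.edgeSet := by
  classical
  have n1 := hab.ne
  have n2 := hbc.ne
  have n3 := hac.ne
  have n4 := hbd.ne
  have n5 := hcd.ne
  have c1 : (K.deleteEdges {s(a, b)}).Connected := by
    apply hK.connected_delete_edge_of_not_isBridge
    rw [isBridge_iff, not_not]
    have e1 : (K.deleteEdges {s(a, b)}).Adj a c := by
      simp [hac]; grind
    have e2 : (K.deleteEdges {s(a, b)}).Adj c b := by
      simp [hbc.symm]; grind
    exact e1.reachable.trans e2.reachable
  have c2 : ((K.deleteEdges {s(a, b)}).deleteEdges {s(b, d)}).Connected := by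
    apply c1.connected_delete_edge_of_not_isBridge
    rw [isBridge_iff, not_not]
    have e1 : ((K.deleteEdges {s(a, b)}).deleteEdges {s(b, d)}).Adj b c := by
      simp [hbc]; grind
    have e2 : ((K.deleteEdges {s(a, b)}).deleteEdges {s(b, d)}).Adj c d := by
      simp [hcd]; grind
    exact e1.reachable.trans e2.reachable
  have hle := c2.card_vert_le_card_edgeSet_add_one
  rw [edgeSet_deleteEdges, edgeSet_deleteEdges, Nat.card_coe_set_eq] at hle
  rw [Nat.card_coe_set_eq]
  have f1 := Set.ncard_diff_singleton_add_one (s := K.edgeSet) (a := s(a, b)) hab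
  have f2 := Set.ncard_diff_singleton_add_one (s := K.edgeSet \ {s(a, b)}) (a := s(b, d))
    ⟨hbd, by simp; grind⟩
  omega

theorem no_diamond {V : Type*} [Fintype V] (G : SimpleGraph V) (n : ℕ) (hodd : Odd n)
    (h : G.indepPoly = Lp n) (a b c d : V)
    (hab : G.Adj a b) (hbc : G.Adj b c) (hac : G.Adj a c) (hbd : G.Adj b d) (hcd : G.Adj c d)
    (had : a ≠ d) : False := by
  classical
  let Q := G.connectedComponentMk a
  let S : Set V := Q.supp
  have hS : ∀ u v, G.Adj u v → (u ∈ S ↔ v ∈ S) := fun u v huv => Q.mem_supp_congr_adj huv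
  have ha : a ∈ S := rfl
  have hb : b ∈ S := (hS _ _ hab).1 ha
  have hc : c ∈ S := (hS _ _ hac).1 ha
  have hd : d ∈ S := (hS _ _ hbd).1 hb
  have hconn : (G.induce S).Connected := Q.connected_toSimpleGraph
  have hk := conn_diamond (G.induce S) hconn ⟨a, ha⟩ ⟨b, hb⟩ ⟨c, hc⟩ ⟨d, hd⟩ hab hbc hac hbd hcd
    (by simpa using had)
  have hmul := indepPoly_mul G S hS
  have hf := factor_coeff n hodd (G.induce S).indepPoly _ (hmul.symm.trans h) (zero_coeff _)
  have h2 := two_coeff (G.induce S)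
  rw [dart_sum] at h2
  rw [h2, one_coeff] at hf
  rw [Nat.card_eq_fintype_card (α := S)] at hk
  have : (Nat.card (G.induce S).edgeSet : ℚ) = Fintype.card S := by
    push_cast at hf
    linarith
  have : Nat.card (G.induce S).edgeSet = Fintype.card S := by exact_mod_cast this
  omega

/-- For odd `n ≥ 5`, if `I(G,x) = I(C_n,x)` then
`n(3n-11)/2 = e_2(G) + n_G(P_3 ∪ K_1) - n_G(C_3 ∪ K_1) - n_G(P_4) - n_G(K_{1,3})
 + n_G(D_4) + n_G(C_4)`, where `e_2(G) = n_G(2P_2)` is the number of matchings of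
size `2` in `G`. -/
theorem i4_subgraph_identity {n : ℕ} (hn : 5 ≤ n) (hodd : Odd n)
    {V : Type} [Fintype V] (G : SimpleGraph V)
    (h : G.indepPoly = (cycleGraph n).indepPoly) :
    (n : ℚ) * (3 * n - 11) / 2 =
      (subgraphCount G (pathGraph 2 ⊕g pathGraph 2) : ℚ)
      + (subgraphCount G (pathGraph 3 ⊕g pathGraph 1) : ℚ)
      - (subgraphCount G (cycleGraph 3 ⊕g pathGraph 1) : ℚ)
      - (subgraphCount G (pathGraph 4) : ℚ)
      - (subgraphCount G (completeBipartiteGraph (Fin 1) (Fin 3)) : ℚ)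
      + (subgraphCount G (Dgraph 4) : ℚ)
      + (subgraphCount G (cycleGraph 4) : ℚ) := by
  classical
  rw [cyc_Lp n (by omega)] at h
  obtain ⟨m, rfl⟩ : ∃ m, n = m + 5 := ⟨n - 5, by omega⟩
  have h1 := (Lp_coeff (m+3)).2.1
  have h2 := (Lp_coeff (m+2)).2.2.1
  have h4 := (Lp_coeff m).2.2.2.2
  rw [show m + 3 + 2 = m + 5 by omega, ← h, one_coeff] at h1
  rw [show m + 2 + 3 = m + 5 by omega, ← h] at h2
  rw [← h] at h4
  have hN : Fintype.card V = m + 5 := by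
    have : (Fintype.card V : ℚ) = ((m + 5 : ℕ) : ℚ) := by rw [h1]; push_cast; ring
    exact_mod_cast this
  have hm := main_count G (no_diamond G (m+5) hodd h) (m+5) hN hn (by
    rw [h2]; push_cast; ring)
  rw [h4] at hm
  push_cast at hm ⊢
  linear_combination hm
end

section
/- For all positive integers m1 and m2, the three graphs A_{m1,m2}, E_{m1,m2} and E_{m2,m1} are pairwise independence equivalent: I(A_{m1,m2},x) = I(E_{m1,m2},x) = I(E_{m2,m1},x). -/
open Polynomial SimpleGraph

/-- `Agraph m1 m2` : a triangle (on `m1`, `m1+1` and the apex `m1+m2+2`) with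
vertex-disjoint pendant paths on `m1` vertices (`0,…,m1-1`) and on `m2` vertices
(`m1+2,…,m1+m2+1`) attached to the two triangle vertices `m1` and `m1+1`. -/
def Agraph (m1 m2 : ℕ) : SimpleGraph (Fin (m1 + m2 + 3)) :=
  SimpleGraph.fromRel (fun i j =>
    (i.val + 1 = j.val ∧ j.val ≤ m1 + m2 + 1) ∨
    (i.val = m1 ∧ j.val = m1 + m2 + 2) ∨
    (i.val = m1 + 1 ∧ j.val = m1 + m2 + 2))

/-- `Egraph m1 m2` : the cycle `C_{m1+3}` (on `0,…,m1+2`) with a pendant path on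
`m2` vertices (`m1+3,…,m1+m2+2`) attached to the cycle vertex `0`. -/
def Egraph (m1 m2 : ℕ) : SimpleGraph (Fin (m1 + m2 + 3)) :=
  SimpleGraph.fromRel (fun i j =>
    (i.val + 1 = j.val ∧ j.val ≤ m1 + 2) ∨
    (i.val = 0 ∧ j.val = m1 + 2) ∨
    (i.val + 1 = j.val ∧ m1 + 3 ≤ i.val) ∨
    (i.val = 0 ∧ j.val = m1 + 3))


open scoped Classical in
noncomputable def wsum {V : Type*} [Fintype V] (p : Finset V → Prop) : Polynomial ℚ :=
  ∑ s : Finset V, if p s then (X : Polynomial ℚ) ^ s.card else 0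

lemma wsum_equiv {V W : Type*} [Fintype V] [Fintype W] (e : V ≃ W) (p : Finset V → Prop)
    (q : Finset W → Prop) (h : ∀ s, q (s.map e.toEmbedding) ↔ p s) : wsum p = wsum q := by
  classical
  unfold wsum
  refine Fintype.sum_equiv (Equiv.finsetCongr e) _ _ (fun s => ?_)
  simp [Equiv.finsetCongr_apply, h]

lemma indepPoly_iso {V W : Type*} [Fintype V] [Fintype W] (e : V ≃ W) (G : SimpleGraph V)
    (H : SimpleGraph W) (h : ∀ v w, H.Adj (e v) (e w) ↔ G.Adj v w) :
    G.indepPoly = H.indepPoly := by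
  refine wsum_equiv e _ _ (fun s => ?_)
  simp only [SimpleGraph.IsIndepFinset, Finset.forall_mem_map, Equiv.coe_toEmbedding, h]

/-- path plus one extra edge -/
def Qgraph (n a b : ℕ) : SimpleGraph (Fin n) :=
  SimpleGraph.fromRel (fun i j => i.val + 1 = j.val ∨ (i.val = a ∧ j.val = b))

def PI {n : ℕ} (s : Finset (Fin n)) : Prop := ∀ i ∈ s, ∀ j ∈ s, i.val + 1 ≠ j.val

lemma Q_poly (n : ℕ) (a b : Fin n) (hab : a ≠ b) :
    (Qgraph n a b).indepPoly = wsum (V := Fin n) PI - wsum (fun s => PI s ∧ a ∈ s ∧ b ∈ s) := by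
  classical
  unfold SimpleGraph.indepPoly wsum
  rw [← Finset.sum_sub_distrib]
  refine Finset.sum_congr rfl (fun s _ => ?_)
  have : (Qgraph n a b).IsIndepFinset s ↔ PI s ∧ ¬ (a ∈ s ∧ b ∈ s) := by
    unfold SimpleGraph.IsIndepFinset PI Qgraph
    simp only [fromRel_adj]
    constructor
    · intro h
      refine ⟨fun i hi j hj hij => h i hi j hj ⟨?_, Or.inl (Or.inl hij)⟩, fun hh => 
        h a hh.1 b hh.2 ⟨hab, Or.inl (Or.inr ⟨rfl, rfl⟩)⟩⟩
      rintro rfl; omega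
    · rintro ⟨h1, h2⟩ i hi j hj ⟨_, (h | ⟨h, h'⟩) | (h | ⟨h, h'⟩)⟩
      · exact h1 i hi j hj h
      · exact h2 ⟨Fin.ext h ▸ hi, Fin.ext h' ▸ hj⟩
      · exact h1 j hj i hi h
      · exact h2 ⟨Fin.ext h ▸ hj, Fin.ext h' ▸ hi⟩
  rw [if_congr this rfl rfl]
  by_cases hp : PI s <;> by_cases ha : a ∈ s ∧ b ∈ s <;> simp [hp, ha]

/-- reflection of `0,…,m` -/
def refl0 (n m : ℕ) (h : m < n) : Fin n ≃ Fin n where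
  toFun i := ⟨if i.val ≤ m then m - i.val else i.val, by split_ifs <;> omega⟩
  invFun i := ⟨if i.val ≤ m then m - i.val else i.val, by split_ifs <;> omega⟩
  left_inv i := by ext; grind
  right_inv i := by ext; grind

lemma Q_eq (n m : ℕ) (h : m + 2 < n) :
    (Qgraph n m (m+2)).indepPoly = (Qgraph n 0 (m+2)).indepPoly := by
  have e1 := Q_poly n ⟨m, by omega⟩ ⟨m+2, h⟩ (by simp)
  have e2 := Q_poly n ⟨0, by omega⟩ ⟨m+2, h⟩ (by simp)
  simp only at e1 e2
  rw [e1, e2]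
  congr 1
  refine wsum_equiv (refl0 n m (by omega)) _ _ (fun s => ?_)
  have hm : (⟨0, by omega⟩ : Fin n) ∈ s.map (refl0 n m (by omega)).toEmbedding
      ↔ (⟨m, by omega⟩ : Fin n) ∈ s := by
    rw [Finset.mem_map_equiv]; simp [refl0]
  have hm2 : (⟨m+2, h⟩ : Fin n) ∈ s.map (refl0 n m (by omega)).toEmbedding
      ↔ (⟨m+2, h⟩ : Fin n) ∈ s := by
    rw [Finset.mem_map_equiv]; simp [refl0]
  rw [hm, hm2]
  refine and_congr_left (fun ⟨ha, hb⟩ => ?_)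
  unfold PI
  simp only [Finset.forall_mem_map, Equiv.coe_toEmbedding]
  constructor
  · intro H i hi j hj hij
    have k1 := H i hi j hj
    have k2 := H j hj i hi
    have k3 := H j hj _ hb
    have k4 := H i hi _ hb
    by_cases c : i.val = m
    · have := H j hj _ hb
      simp only [refl0, Equiv.coe_fn_mk] at this
      grind
    · simp only [refl0, Equiv.coe_fn_mk] at k1 k2 k3
      grind
  · intro H i hi j hj hij
    have k1 := H i hi j hj
    have k2 := H j hj i hi
    have k3 := H j hj _ hb
    have k4 := H _ ha j hj
    simp only [refl0, Equiv.coe_fn_mk] at hij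
    grind

def eA (m1 m2 : ℕ) : Fin (m1 + m2 + 3) ≃ Fin (m1 + m2 + 3) where
  toFun i := ⟨if i.val ≤ m1 then i.val else if i.val = m1 + m2 + 2 then m1 + 1 else i.val + 1,
    by split_ifs <;> omega⟩
  invFun i := ⟨if i.val ≤ m1 then i.val else if i.val = m1 + 1 then m1 + m2 + 2 else i.val - 1,
    by split_ifs <;> omega⟩
  left_inv i := by ext; grind
  right_inv i := by ext; grind

def eE (m1 m2 : ℕ) : Fin (m1 + m2 + 3) ≃ Fin (m1 + m2 + 3) where
  toFun i := ⟨if i.val = 0 then m1 + 2 else if i.val ≤ m1 + 2 then i.val - 1 else i.val,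
    by split_ifs <;> omega⟩
  invFun i := ⟨if i.val = m1 + 2 then 0 else if i.val < m1 + 2 then i.val + 1 else i.val,
    by split_ifs <;> omega⟩
  left_inv i := by ext; grind
  right_inv i := by ext; grind

def eS (m1 m2 : ℕ) : Fin (m1 + m2 + 3) ≃ Fin (m2 + m1 + 3) where
  toFun i := ⟨if i.val = m1 + m2 + 2 then m1 + m2 + 2 else m1 + m2 + 1 - i.val,
    by split_ifs <;> omega⟩
  invFun i := ⟨if i.val = m1 + m2 + 2 then m1 + m2 + 2 else m1 + m2 + 1 - i.val,
    by split_ifs <;> omega⟩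
  left_inv i := by ext; grind
  right_inv i := by ext; grind

lemma A_eq_Q (m1 m2 : ℕ) :
    (Agraph m1 m2).indepPoly = (Qgraph (m1+m2+3) m1 (m1+2)).indepPoly := by
  refine indepPoly_iso (eA m1 m2) _ _ (fun ⟨v, hv⟩ ⟨w, hw⟩ => ?_)
  simp only [Agraph, Qgraph, fromRel_adj, eA, Equiv.coe_fn_mk, ne_eq, Fin.mk.injEq]
  split_ifs <;> omega

lemma E_eq_Q (m1 m2 : ℕ) :
    (Egraph m1 m2).indepPoly = (Qgraph (m1+m2+3) 0 (m1+2)).indepPoly := by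
  refine indepPoly_iso (eE m1 m2) _ _ (fun ⟨v, hv⟩ ⟨w, hw⟩ => ?_)
  simp only [Egraph, Qgraph, fromRel_adj, eE, Equiv.coe_fn_mk, ne_eq, Fin.mk.injEq]
  split_ifs <;> omega

lemma A_symm (m1 m2 : ℕ) : (Agraph m1 m2).indepPoly = (Agraph m2 m1).indepPoly := by
  refine indepPoly_iso (eS m1 m2) _ _ (fun ⟨v, hv⟩ ⟨w, hw⟩ => ?_)
  simp only [Agraph, fromRel_adj, eS, Equiv.coe_fn_mk, ne_eq, Fin.mk.injEq]
  split_ifs <;> omega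

lemma A_eq_E (m1 m2 : ℕ) (h2 : 1 ≤ m2) :
    (Agraph m1 m2).indepPoly = (Egraph m1 m2).indepPoly := by
  rw [A_eq_Q, E_eq_Q, Q_eq]; omega

/-- For all positive `m1, m2`, the graphs `A_{m1,m2}`, `E_{m1,m2}` and `E_{m2,m1}` are
pairwise independence equivalent. -/
theorem indepPoly_A_eq_E (m1 m2 : ℕ) (h1 : 1 ≤ m1) (h2 : 1 ≤ m2) :
    (Agraph m1 m2).indepPoly = (Egraph m1 m2).indepPoly ∧
    (Agraph m1 m2).indepPoly = (Egraph m2 m1).indepPoly :=  by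
  exact ⟨A_eq_E m1 m2 h2, (A_symm m1 m2).trans (A_eq_E m2 m1 h1)⟩
end

section
/- For all positive integers m1 and m2, I(A_{m1,m2},x) = I(P_{m1+m2+2},x) + x · I(P_{m1},x) · I(P_{m2},x). -/
open Polynomial SimpleGraph

open scoped Classical in
theorem indepPoly_eq_filter {V : Type*} [Fintype V] (G : SimpleGraph V) :
    G.indepPoly = ∑ s ∈ Finset.univ.filter (fun s : Finset V => G.IsIndepFinset s),
      (X : Polynomial ℚ) ^ s.card := by
  unfold SimpleGraph.indepPoly
  rw [Finset.sum_filter]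

theorem Agraph_adj_iff (m1 m2 : ℕ) (i j : Fin (m1 + m2 + 3)) :
    (Agraph m1 m2).Adj i j ↔
      ((i.val + 1 = j.val ∧ j.val ≤ m1 + m2 + 1) ∨
        ((i.val = m1 ∨ i.val = m1 + 1) ∧ j.val = m1 + m2 + 2)) ∨
      ((j.val + 1 = i.val ∧ i.val ≤ m1 + m2 + 1) ∨
        ((j.val = m1 ∨ j.val = m1 + 1) ∧ i.val = m1 + m2 + 2)) := by
  simp only [Agraph, SimpleGraph.fromRel_adj, ne_eq, Fin.ext_iff]
  omega

def embL (m1 m2 : ℕ) : Fin m1 ↪ Fin (m1 + m2 + 3) :=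
  ⟨fun i => ⟨i.val, by omega⟩, fun i j h => by simpa [Fin.ext_iff] using h⟩

def embR (m1 m2 : ℕ) : Fin m2 ↪ Fin (m1 + m2 + 3) :=
  ⟨fun i => ⟨m1 + 2 + i.val, by omega⟩, fun i j h => by simpa [Fin.ext_iff] using h⟩

def embP (m1 m2 : ℕ) : Fin (m1 + m2 + 2) ↪ Fin (m1 + m2 + 3) :=
  ⟨fun i => ⟨i.val, by omega⟩, fun i j h => by simpa [Fin.ext_iff] using h⟩

def apexV (m1 m2 : ℕ) : Fin (m1 + m2 + 3) := ⟨m1 + m2 + 2, by omega⟩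

theorem embL_val (m1 m2 : ℕ) (i : Fin m1) : (embL m1 m2 i).val = i.val := rfl

theorem embR_val (m1 m2 : ℕ) (i : Fin m2) : (embR m1 m2 i).val = m1 + 2 + i.val := rfl

theorem embP_val (m1 m2 : ℕ) (i : Fin (m1 + m2 + 2)) : (embP m1 m2 i).val = i.val := rfl

theorem apexV_val (m1 m2 : ℕ) : (apexV m1 m2).val = m1 + m2 + 2 := rfl

theorem sum_no_apex (m1 m2 : ℕ) [DecidablePred (Agraph m1 m2).IsIndepFinset]
    [DecidablePred (pathGraph (m1 + m2 + 2)).IsIndepFinset] :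
    ∑ s ∈ (Finset.univ.filter (fun s => (Agraph m1 m2).IsIndepFinset s)).filter
        (fun s => ¬ apexV m1 m2 ∈ s), (X : Polynomial ℚ) ^ s.card =
    ∑ s ∈ Finset.univ.filter (fun s => (pathGraph (m1 + m2 + 2)).IsIndepFinset s),
      (X : Polynomial ℚ) ^ s.card := by
  symm
  refine Finset.sum_bij (fun s _ => s.map (embP m1 m2)) ?_ ?_ ?_ ?_
  · intro s hs
    simp only [Finset.mem_filter, Finset.mem_univ, true_and] at hs ⊢
    constructor
    · intro v hv w hw hadj
      obtain ⟨v', hv', rfl⟩ := Finset.mem_map.1 hv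
      obtain ⟨w', hw', rfl⟩ := Finset.mem_map.1 hw
      apply hs v' hv' w' hw'
      rw [Agraph_adj_iff] at hadj
      rw [pathGraph_adj]
      simp only [embP_val] at hadj
      omega
    · intro h
      obtain ⟨v, hv, h⟩ := Finset.mem_map.1 h
      simp only [embP_val, apexV_val, Fin.ext_iff] at h
      omega
  · intro a _ b _ h
    exact Finset.map_injective _ h
  · intro s hs
    simp only [Finset.mem_filter, Finset.mem_univ, true_and] at hs
    refine ⟨Finset.univ.filter (fun i => embP m1 m2 i ∈ s), ?_, ?_⟩
    · simp only [Finset.mem_filter, Finset.mem_univ, true_and]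
      intro v hv w hw hadj
      simp only [Finset.mem_filter, Finset.mem_univ, true_and] at hv hw
      apply hs.1 _ hv _ hw
      rw [pathGraph_adj] at hadj
      rw [Agraph_adj_iff]
      simp only [embP_val]
      omega
    · ext v
      simp only [Finset.mem_map, Finset.mem_filter, Finset.mem_univ, true_and]
      constructor
      · rintro ⟨i, hi, rfl⟩; exact hi
      · intro hv
        have hne : v.val ≠ m1 + m2 + 2 := fun h => hs.2 (by
          have : v = apexV m1 m2 := Fin.ext h
          rwa [← this])
        exact ⟨⟨v.val, by omega⟩, hv, rfl⟩
  · intro s _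
    rw [Finset.card_map]

theorem sum_apex (m1 m2 : ℕ) [DecidablePred (Agraph m1 m2).IsIndepFinset]
    [DecidablePred (pathGraph m1).IsIndepFinset] [DecidablePred (pathGraph m2).IsIndepFinset] :
    ∑ s ∈ (Finset.univ.filter (fun s => (Agraph m1 m2).IsIndepFinset s)).filter
        (fun s => apexV m1 m2 ∈ s), (X : Polynomial ℚ) ^ s.card =
    ∑ p ∈ (Finset.univ.filter (fun s => (pathGraph m1).IsIndepFinset s)) ×ˢ
        (Finset.univ.filter (fun s => (pathGraph m2).IsIndepFinset s)),
      X * ((X : Polynomial ℚ) ^ p.1.card * X ^ p.2.card) := by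
  have memL : ∀ (a : Finset (Fin m1)) (b : Finset (Fin m2)) (v : Fin (m1 + m2 + 3)),
      v ∈ insert (apexV m1 m2) (a.map (embL m1 m2) ∪ b.map (embR m1 m2)) ↔
        v.val = m1 + m2 + 2 ∨ (∃ i ∈ a, i.val = v.val) ∨ (∃ i ∈ b, m1 + 2 + i.val = v.val) := by
    intro a b v
    simp [apexV_val, embL_val, embR_val, Fin.ext_iff]
  symm
  refine Finset.sum_bij
    (fun p _ => insert (apexV m1 m2) (p.1.map (embL m1 m2) ∪ p.2.map (embR m1 m2))) ?_ ?_ ?_ ?_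
  · rintro ⟨a, b⟩ hs
    simp only [Finset.mem_product, Finset.mem_filter, Finset.mem_univ, true_and] at hs ⊢
    refine ⟨?_, Finset.mem_insert_self _ _⟩
    intro v hv w hw hadj
    rw [memL] at hv hw
    rw [Agraph_adj_iff] at hadj
    have ha : ∀ i ∈ a, ∀ j ∈ a, i.val + 1 ≠ j.val := fun i hi j hj h =>
      hs.1 i hi j hj (pathGraph_adj.2 (Or.inl h))
    have hb : ∀ i ∈ b, ∀ j ∈ b, i.val + 1 ≠ j.val := fun i hi j hj h =>
      hs.2 i hi j hj (pathGraph_adj.2 (Or.inl h))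
    rcases hv with hv | ⟨i, hi, hv⟩ | ⟨i, hi, hv⟩ <;>
    rcases hw with hw | ⟨j, hj, hw⟩ | ⟨j, hj, hw⟩
    · omega
    · omega
    · omega
    · omega
    · have := ha i hi j hj; have := ha j hj i hi; omega
    · omega
    · omega
    · omega
    · have := hb i hi j hj; have := hb j hj i hi; omega
  · rintro ⟨a, b⟩ _ ⟨c, d⟩ _ h
    have key := fun v => (memL a b v).symm.trans ((Finset.ext_iff.1 h v).trans (memL c d v))
    have e1 : a = c := by
      ext i
      have := key (embL m1 m2 i)
      simp only [embL_val] at this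
      constructor
      · intro hi
        rcases this.1 (Or.inr (Or.inl ⟨i, hi, rfl⟩)) with h | ⟨j, hj, h⟩ | ⟨j, hj, h⟩
        · omega
        · rwa [← Fin.ext h]
        · omega
      · intro hi
        rcases this.2 (Or.inr (Or.inl ⟨i, hi, rfl⟩)) with h | ⟨j, hj, h⟩ | ⟨j, hj, h⟩
        · omega
        · rwa [← Fin.ext h]
        · omega
    have e2 : b = d := by
      ext i
      have := key (embR m1 m2 i)
      simp only [embR_val] at this
      constructor
      · intro hi
        rcases this.1 (Or.inr (Or.inr ⟨i, hi, rfl⟩)) with h | ⟨j, hj, h⟩ | ⟨j, hj, h⟩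
        · omega
        · omega
        · rwa [← Fin.ext (Nat.add_left_cancel h)]
      · intro hi
        rcases this.2 (Or.inr (Or.inr ⟨i, hi, rfl⟩)) with h | ⟨j, hj, h⟩ | ⟨j, hj, h⟩
        · omega
        · omega
        · rwa [← Fin.ext (Nat.add_left_cancel h)]
    rw [e1, e2]
  · intro s hs
    simp only [Finset.mem_filter, Finset.mem_univ, true_and] at hs
    refine ⟨(Finset.univ.filter (fun i => embL m1 m2 i ∈ s),
      Finset.univ.filter (fun i => embR m1 m2 i ∈ s)), ?_, ?_⟩
    · simp only [Finset.mem_product, Finset.mem_filter, Finset.mem_univ, true_and]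
      constructor
      · intro v hv w hw hadj
        simp only [Finset.mem_filter, Finset.mem_univ, true_and] at hv hw
        apply hs.1 _ hv _ hw
        rw [pathGraph_adj] at hadj
        rw [Agraph_adj_iff]
        simp only [embL_val]
        omega
      · intro v hv w hw hadj
        simp only [Finset.mem_filter, Finset.mem_univ, true_and] at hv hw
        apply hs.1 _ hv _ hw
        rw [pathGraph_adj] at hadj
        rw [Agraph_adj_iff]
        simp only [embR_val]
        omega
    · ext v
      rw [memL]
      simp only [Finset.mem_filter, Finset.mem_univ, true_and]
      constructor
      · rintro (h | ⟨i, hi, h⟩ | ⟨i, hi, h⟩)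
        · have : v = apexV m1 m2 := Fin.ext h
          rw [this]; exact hs.2
        · have : v = embL m1 m2 i := Fin.ext h.symm
          rwa [this]
        · have : v = embR m1 m2 i := Fin.ext h.symm
          rwa [this]
      · intro hv
        have hn := hs.1 v hv _ hs.2
        rw [Agraph_adj_iff] at hn
        have hn1 : v.val ≠ m1 := fun h => hn (Or.inl (Or.inr ⟨Or.inl h, rfl⟩))
        have hn2 : v.val ≠ m1 + 1 := fun h => hn (Or.inl (Or.inr ⟨Or.inr h, rfl⟩))
        by_cases h1 : v.val = m1 + m2 + 2
        · exact Or.inl h1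
        by_cases h2 : v.val < m1
        · exact Or.inr (Or.inl ⟨⟨v.val, h2⟩, hv, rfl⟩)
        · refine Or.inr (Or.inr ⟨⟨v.val - (m1 + 2), by omega⟩, ?_, ?_⟩)
          · have : embR m1 m2 ⟨v.val - (m1 + 2), by omega⟩ = v := by
              apply Fin.ext
              simp only [embR_val]
              omega
            rwa [this]
          · simp only
            omega
  · rintro ⟨a, b⟩ _
    rw [Finset.card_insert_of_notMem, Finset.card_union_of_disjoint, Finset.card_map,
      Finset.card_map]
    · ring
    · rw [Finset.disjoint_left]
      intro v hv hw
      simp only [Finset.mem_map, embL_val, embR_val, Fin.ext_iff] at hv hw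
      obtain ⟨i, _, hi⟩ := hv
      obtain ⟨j, _, hj⟩ := hw
      omega
    · simp only [Finset.mem_union, Finset.mem_map, embL_val, embR_val, apexV_val, Fin.ext_iff]
      rintro (⟨i, _, hi⟩ | ⟨i, _, hi⟩) <;> omega

/-- `I(A_{m1,m2},x) = I(P_{m1+m2+2},x) + x·I(P_{m1},x)·I(P_{m2},x)`. -/
theorem indepPoly_Agraph (m1 m2 : ℕ) (h1 : 1 ≤ m1) (h2 : 1 ≤ m2) :
    (Agraph m1 m2).indepPoly =
      (pathGraph (m1 + m2 + 2)).indepPoly +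
        X * (pathGraph m1).indepPoly * (pathGraph m2).indepPoly := by
  classical
  rw [indepPoly_eq_filter (Agraph m1 m2), ← Finset.sum_filter_add_sum_filter_not _
    (fun s => apexV m1 m2 ∈ s), sum_no_apex, sum_apex, add_comm,
    indepPoly_eq_filter (pathGraph (m1 + m2 + 2)), indepPoly_eq_filter (pathGraph m1),
    indepPoly_eq_filter (pathGraph m2), mul_assoc, Finset.sum_mul_sum, ← Finset.sum_product',
    Finset.mul_sum]
end

section
/- For all integers m1 ≥ 1 and m2, m3 ≥ 1, I(B_{m1,m2,m3},x) = I(C_{m1+3},x) · I(P_{m2},x) · I(P_{m3},x) + x · I(C_{m1+2},x) · I(P_{m2−1},x) · I(P_{m3−1},x), with the convention that I(P_0,x) = 1. -/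
open Polynomial SimpleGraph

/-- `Bgraph m1 m2 m3` : a triangle `0,1,2`, a path `3,…,m1+2` ending in the vertex
`v = m1+3`, with `3` joined to the triangle vertex `2` (if `m1 = 0` then `v` is joined
directly to `2`), and two vertex-disjoint pendant paths on `m2` vertices
(`m1+4,…,m1+m2+3`) and on `m3` vertices (`m1+m2+4,…,m1+m2+m3+3`) attached to `v`. -/
def Bgraph (m1 m2 m3 : ℕ) : SimpleGraph (Fin (m1 + m2 + m3 + 4)) :=
  SimpleGraph.fromRel (fun i j =>
    (i.val + 1 = j.val ∧ j.val ≤ m1 + 3) ∨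
    (i.val = 0 ∧ j.val = 2) ∨
    (i.val + 1 = j.val ∧ m1 + 4 ≤ i.val ∧ j.val ≤ m1 + m2 + 3) ∨
    (i.val = m1 + 3 ∧ j.val = m1 + 4) ∨
    (i.val + 1 = j.val ∧ m1 + m2 + 4 ≤ i.val) ∨
    (i.val = m1 + 3 ∧ j.val = m1 + m2 + 4))

open scoped Classical in
noncomputable def JP {V : Type*} (G : SimpleGraph V) (S : Finset V) : Polynomial ℚ :=
  ∑ s ∈ S.powerset, if G.IsIndepFinset s then (X : Polynomial ℚ) ^ s.card else 0

theorem indepPoly_eq_JP {V : Type*} [Fintype V] (G : SimpleGraph V) :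
    G.indepPoly = JP G Finset.univ := by
  simp [SimpleGraph.indepPoly, JP]

theorem JP_map {V W : Type*} (G : SimpleGraph V) (H : SimpleGraph W) (S : Finset V) (f : V ↪ W)
    (h : ∀ a ∈ S, ∀ b ∈ S, G.Adj a b ↔ H.Adj (f a) (f b)) :
    JP G S = JP H (S.map f) := by
  classical
  unfold JP
  refine Finset.sum_bij (fun s _ => s.map f) ?_ ?_ ?_ ?_
  · intro s hs
    simpa using hs
  · intro a _ b _ hab
    exact Finset.map_injective f hab
  · intro t ht
    rw [Finset.mem_powerset, Finset.subset_map_iff] at ht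
    obtain ⟨u, hu, rfl⟩ := ht
    exact ⟨u, by simpa using hu, rfl⟩
  · intro s hs
    rw [Finset.mem_powerset] at hs
    have : G.IsIndepFinset s ↔ H.IsIndepFinset (s.map f) := by
      simp only [SimpleGraph.IsIndepFinset, Finset.mem_map, forall_exists_index, and_imp,
        forall_apply_eq_imp_iff₂]
      exact forall₂_congr fun a ha => forall₂_congr fun b hb => not_congr (h a (hs ha) b (hs hb))
    simp [this]

theorem JP_congr {V : Type*} (G H : SimpleGraph V) (S : Finset V)
    (h : ∀ a ∈ S, ∀ b ∈ S, G.Adj a b ↔ H.Adj a b) : JP G S = JP H S := by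
  have := JP_map G H S (Function.Embedding.refl V) h
  simpa using this

theorem JP_disj {V : Type*} [DecidableEq V] (G : SimpleGraph V) (S T : Finset V)
    (hd : Disjoint S T)
    (h : ∀ a ∈ S, ∀ b ∈ T, ¬ G.Adj a b) : JP G (S ∪ T) = JP G S * JP G T := by
  classical
  unfold JP
  rw [Finset.sum_mul_sum, ← Finset.sum_product']
  symm
  refine Finset.sum_bij (fun p _ => p.1 ∪ p.2) ?_ ?_ ?_ ?_
  · rintro ⟨a, b⟩ hp
    simp only [Finset.mem_product, Finset.mem_powerset] at hp ⊢
    exact Finset.union_subset_union hp.1 hp.2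
  · rintro ⟨a, b⟩ hp ⟨c, d⟩ hq he
    simp only [Finset.mem_product, Finset.mem_powerset] at hp hq he
    rw [Finset.disjoint_left] at hd
    have e : ∀ x, (x ∈ a ∨ x ∈ b) ↔ (x ∈ c ∨ x ∈ d) := by
      intro x; simpa using congrArg (x ∈ ·) he
    ext x
    · have := e x
      have := @hp.1 x
      have := @hp.2 x
      have := @hq.1 x
      have := @hq.2 x
      have := @hd x
      tauto
    · have := e x
      have := @hp.1 x
      have := @hp.2 x
      have := @hq.1 x
      have := @hq.2 x
      have := @hd x
      tauto
  · intro t ht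
    rw [Finset.mem_powerset] at ht
    refine ⟨(t ∩ S, t ∩ T), ?_, ?_⟩
    · simp
    · simp only
      rw [← Finset.inter_union_distrib_left, Finset.inter_eq_left.2 ht]
  · rintro ⟨a, b⟩ hp
    simp only [Finset.mem_product, Finset.mem_powerset] at hp ⊢
    have hc : (a ∪ b).card = a.card + b.card :=
      Finset.card_union_of_disjoint (Finset.disjoint_of_subset_left hp.1
        (Finset.disjoint_of_subset_right hp.2 hd))
    have hi : G.IsIndepFinset (a ∪ b) ↔ G.IsIndepFinset a ∧ G.IsIndepFinset b := by
      constructor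
      · intro hh
        exact ⟨fun v hv w hw => hh v (Finset.mem_union_left _ hv) w (Finset.mem_union_left _ hw),
          fun v hv w hw => hh v (Finset.mem_union_right _ hv) w (Finset.mem_union_right _ hw)⟩
      · rintro ⟨h1, h2⟩ v hv w hw
        rcases Finset.mem_union.1 hv with hv | hv <;> rcases Finset.mem_union.1 hw with hw | hw
        · exact h1 v hv w hw
        · exact h v (hp.1 hv) w (hp.2 hw)
        · exact fun hh => h w (hp.1 hw) v (hp.2 hv) hh.symm
        · exact h2 v hv w hw
    rw [hc, pow_add]
    by_cases h1 : G.IsIndepFinset a <;> by_cases h2 : G.IsIndepFinset b <;> simp [hi, h1, h2]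

/-- deletion; `T` is the set of non-neighbours of `v` in `S`. -/
theorem JP_insert {V : Type*} [DecidableEq V] (G : SimpleGraph V) (S T : Finset V) (v : V)
    (hv : v ∉ S) (hT : ∀ x, x ∈ T ↔ x ∈ S ∧ ¬ G.Adj v x) :
    JP G (insert v S) = JP G S + X * JP G T := by
  classical
  unfold JP
  rw [Finset.sum_powerset_insert hv]
  congr 1
  rw [Finset.mul_sum]
  symm
  have hTS : T ⊆ S := fun x hx => ((hT x).1 hx).1
  apply Finset.sum_subset_zero_on_sdiff (Finset.powerset_mono.2 hTS)
  · intro s hs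
    rw [Finset.mem_sdiff, Finset.mem_powerset, Finset.mem_powerset] at hs
    rw [if_neg]
    intro hi
    apply hs.2
    intro x hx
    exact (hT x).2 ⟨hs.1 hx, hi v (Finset.mem_insert_self _ _) x (Finset.mem_insert_of_mem hx)⟩
  · intro s hs
    rw [Finset.mem_powerset] at hs
    have hvs : v ∉ s := fun h => hv (hTS (hs h))
    have hi : G.IsIndepFinset (insert v s) ↔ G.IsIndepFinset s := by
      constructor
      · intro hh a ha b hb
        exact hh a (Finset.mem_insert_of_mem ha) b (Finset.mem_insert_of_mem hb)
      · intro hh a ha b hb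
        rcases Finset.mem_insert.1 ha with ha | ha <;> rcases Finset.mem_insert.1 hb with hb | hb
        · rw [ha, hb]; exact G.irrefl
        · rw [ha]; exact ((hT b).1 (hs hb)).2
        · rw [hb]; exact fun h => ((hT a).1 (hs ha)).2 h.symm
        · exact hh a ha b hb
    rw [Finset.card_insert_of_notMem hvs]
    by_cases h : G.IsIndepFinset s
    · simp [hi, h, pow_succ']
    · simp [hi, h]

/-- An interval on which `G` is a path. -/
theorem JP_Ico (G : SimpleGraph ℕ) (a n : ℕ)
    (h : ∀ i j, a ≤ i → i < a + n → a ≤ j → j < a + n →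
      (G.Adj i j ↔ (i + 1 = j ∨ j + 1 = i))) :
    JP G (Finset.Ico a (a + n)) = (pathGraph n).indepPoly := by
  rw [indepPoly_eq_JP]
  rw [JP_map (pathGraph n) G Finset.univ (Fin.valEmbedding.trans (addLeftEmbedding a))]
  · congr 1
    ext x
    simp only [Finset.mem_Ico, Finset.mem_map, Finset.mem_univ, true_and,
      Function.Embedding.trans_apply, Fin.valEmbedding_apply, addLeftEmbedding_apply]
    constructor
    · intro hx
      exact ⟨⟨x - a, by omega⟩, by simp; omega⟩
    · rintro ⟨y, rfl⟩
      have := y.2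
      omega
  · intro i _ j _
    simp only [Function.Embedding.trans_apply, Fin.valEmbedding_apply, addLeftEmbedding_apply]
    rw [h _ _ (by omega) (by have := i.2; omega) (by omega) (by have := j.2; omega),
      pathGraph_adj]
    omega

theorem indepPoly_fin {n : ℕ} (G : SimpleGraph (Fin n)) (H : SimpleGraph ℕ)
    (h : ∀ a b : Fin n, G.Adj a b ↔ H.Adj a b) : G.indepPoly = JP H (Finset.range n) := by
  rw [indepPoly_eq_JP, JP_map G H Finset.univ Fin.valEmbedding (fun a _ b _ => h a b)]
  congr 1
  ext x
  simp only [Finset.mem_map, Finset.mem_univ, true_and, Fin.valEmbedding_apply, Finset.mem_range]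
  exact ⟨fun ⟨y, hy⟩ => hy ▸ y.2, fun hx => ⟨⟨x, hx⟩, rfl⟩⟩

def natCycle (n : ℕ) : SimpleGraph ℕ :=
  SimpleGraph.fromRel (fun i j => i + 1 = j ∨ (i = 0 ∧ j + 1 = n))

theorem cyc_rec (n : ℕ) : (cycleGraph (n + 3)).indepPoly =
    (pathGraph (n + 2)).indepPoly + X * (pathGraph n).indepPoly := by
  rw [indepPoly_fin _ (natCycle (n + 3))]
  · have e : Finset.range (n + 3) = insert 0 (Finset.Ico 1 (1 + (n + 2))) := by
      ext x; simp; omega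
    rw [e, JP_insert _ _ (Finset.Ico 2 (2 + n)), JP_Ico, JP_Ico]
    · intro i j _ _ _ _
      simp only [natCycle, SimpleGraph.fromRel_adj]
      omega
    · intro i j _ _ _ _
      simp only [natCycle, SimpleGraph.fromRel_adj]
      omega
    · simp
    · intro x
      simp only [natCycle, SimpleGraph.fromRel_adj, true_and, Finset.mem_Ico]
      omega
  · intro a b
    rw [cycleGraph_adj']
    simp only [natCycle, SimpleGraph.fromRel_adj]
    have := a.2
    have := b.2
    rcases le_total a b with hab | hab
    · rw [Fin.sub_val_of_le hab]
      rcases eq_or_lt_of_le hab with rfl | hlt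
      · simp
      · rw [Fin.coe_sub_iff_lt.2 hlt]
        rw [Fin.lt_def] at hlt
        omega
    · rw [Fin.sub_val_of_le hab]
      rcases eq_or_lt_of_le hab with rfl | hlt
      · simp
      · rw [Fin.coe_sub_iff_lt.2 hlt]
        rw [Fin.lt_def] at hlt
        omega

def natB (m1 m2 : ℕ) : SimpleGraph ℕ :=
  SimpleGraph.fromRel (fun i j =>
    (i + 1 = j ∧ j ≤ m1 + 3) ∨
    (i = 0 ∧ j = 2) ∨
    (i + 1 = j ∧ m1 + 4 ≤ i ∧ j ≤ m1 + m2 + 3) ∨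
    (i = m1 + 3 ∧ j = m1 + 4) ∨
    (i + 1 = j ∧ m1 + m2 + 4 ≤ i) ∨
    (i = m1 + 3 ∧ j = m1 + m2 + 4))

theorem JP_D (m1 m2 n : ℕ) (hn : n ≤ m1) :
    JP (natB m1 m2) (Finset.range (n + 3)) = (cycleGraph (n + 3)).indepPoly := by
  have e : Finset.range (n + 3) = insert 0 (Finset.Ico 1 (1 + (n + 2))) := by
    ext x; simp; omega
  rw [cyc_rec, e, JP_insert _ _ (Finset.Ico 3 (3 + n)), JP_Ico, JP_Ico]
  · intro i j _ _ _ _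
    simp only [natB, SimpleGraph.fromRel_adj]
    omega
  · intro i j _ _ _ _
    simp only [natB, SimpleGraph.fromRel_adj]
    omega
  · simp
  · intro x
    simp only [natB, SimpleGraph.fromRel_adj, true_and, Finset.mem_Ico]
    omega

/-- For `m1 ≥ 1` and `m2, m3 ≥ 1`,
`I(B_{m1,m2,m3},x) = I(C_{m1+3},x)·I(P_{m2},x)·I(P_{m3},x)
 + x·I(C_{m1+2},x)·I(P_{m2-1},x)·I(P_{m3-1},x)`
(with `I(P_0,x) = 1`, as `P_0` is the empty graph). -/
theorem indepPoly_Bgraph (m1 m2 m3 : ℕ) (h1 : 1 ≤ m1) (h2 : 1 ≤ m2) (h3 : 1 ≤ m3) :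
    (Bgraph m1 m2 m3).indepPoly =
      (cycleGraph (m1 + 3)).indepPoly * (pathGraph m2).indepPoly *
        (pathGraph m3).indepPoly +
      X * (cycleGraph (m1 + 2)).indepPoly * (pathGraph (m2 - 1)).indepPoly *
        (pathGraph (m3 - 1)).indepPoly := by
  obtain ⟨n, rfl⟩ : ∃ n, m1 = n + 1 := ⟨m1 - 1, by omega⟩
  obtain ⟨a, rfl⟩ : ∃ n, m2 = n + 1 := ⟨m2 - 1, by omega⟩
  obtain ⟨b, rfl⟩ : ∃ n, m3 = n + 1 := ⟨m3 - 1, by omega⟩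
  rw [indepPoly_fin _ (natB (n + 1) (a + 1))]
  · have e : Finset.range (n + 1 + (a + 1) + (b + 1) + 4) = insert (n + 4)
        ((Finset.range (n + 1 + 3) ∪ Finset.Ico (n + 5) (n + 5 + (a + 1))) ∪
          Finset.Ico (n + a + 6) (n + a + 6 + (b + 1))) := by
      ext x; simp; omega
    rw [e, JP_insert _ _ ((Finset.range (n + 3) ∪ Finset.Ico (n + 6) (n + 6 + a)) ∪
          Finset.Ico (n + a + 7) (n + a + 7 + b))]
    · rw [JP_disj, JP_disj, JP_disj, JP_disj, JP_D _ _ _ le_rfl, JP_D _ _ _ (by omega),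
        JP_Ico, JP_Ico, JP_Ico, JP_Ico]
      · change _ = _ + X * (cycleGraph (n + 3)).indepPoly * (pathGraph a).indepPoly *
          (pathGraph b).indepPoly
        ring
      all_goals first
        | (intro i j _ _ _ _
           simp only [natB, SimpleGraph.fromRel_adj]
           omega)
        | (rw [Finset.disjoint_left]
           intro x
           simp only [Finset.mem_union, Finset.mem_range, Finset.mem_Ico]
           omega)
        | (intro i hi j hj
           simp only [Finset.mem_union, Finset.mem_range, Finset.mem_Ico] at hi hj
           simp only [natB, SimpleGraph.fromRel_adj]
           omega)
    · simp only [Finset.mem_union, Finset.mem_range, Finset.mem_Ico]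
      omega
    · intro x
      simp only [natB, SimpleGraph.fromRel_adj, true_and, Finset.mem_union, Finset.mem_range,
        Finset.mem_Ico]
      omega
  · intro i j
    simp only [Bgraph, natB, SimpleGraph.fromRel_adj, ne_eq, Fin.ext_iff]
end
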